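/- Let X ⊂ ℂⁿ be a taut domain whose Bergman pseudodistance d^b_X is a distance. If h_X(x⁰) > 0 for some point x⁰ ∈ X, then the infimum defining h_X(x⁰) is attained: there exists an injective holomorphic map F : 𝔹ⁿ → X with B_X(x⁰, 1/h_X(x⁰)) ⊆ F(𝔹ⁿ). -/

import Mathlib

open MeasureTheory Metric Filter Topology Set
open scoped ENNReal

noncomputable section

/-- Membership in the Bergman space `A²(Ω)`: holomorphic and square-integrable. -/
def MemA2 {n : ℕ} (Ω : Set (Fin n → ℂ)) (f : (Fin n → ℂ) → ℂ) : Prop :=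
  DifferentiableOn ℂ f Ω ∧ MemLp f 2 (volume.restrict Ω)

/-- `K` is the Bergman kernel of `Ω`: the reproducing kernel of `A²(Ω)`. -/
def IsBergmanKernel {n : ℕ} (Ω : Set (Fin n → ℂ)) (K : (Fin n → ℂ) → (Fin n → ℂ) → ℂ) : Prop :=
  (∀ w ∈ Ω, MemA2 Ω fun z => K z w) ∧
  ∀ f, MemA2 Ω f → ∀ w ∈ Ω, f w = ∫ z in Ω, f z * (starRingEnd ℂ) (K z w)

/-- Wirtinger derivative `∂f/∂z_μ`. -/
def wderiv {n : ℕ} (μ : Fin n) (f : (Fin n → ℂ) → ℂ) (z : Fin n → ℂ) : ℂ :=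
  (fderiv ℝ f z (Pi.single μ 1) - Complex.I * fderiv ℝ f z (Pi.single μ Complex.I)) / 2

/-- Wirtinger derivative `∂f/∂z̄_μ`. -/
def wderivBar {n : ℕ} (μ : Fin n) (f : (Fin n → ℂ) → ℂ) (z : Fin n → ℂ) : ℂ :=
  (fderiv ℝ f z (Pi.single μ 1) + Complex.I * fderiv ℝ f z (Pi.single μ Complex.I)) / 2

/-- One-variable Wirtinger derivative `∂f/∂z`. -/
def wderiv1 (f : ℂ → ℂ) (z : ℂ) : ℂ :=
  (fderiv ℝ f z 1 - Complex.I * fderiv ℝ f z Complex.I) / 2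

/-- One-variable Wirtinger derivative `∂f/∂z̄`. -/
def wderiv1Bar (f : ℂ → ℂ) (z : ℂ) : ℂ :=
  (fderiv ℝ f z 1 + Complex.I * fderiv ℝ f z Complex.I) / 2

/-- Bergman metric tensor `g_{μν}(z) = ∂² log K(z,z) / ∂z_μ ∂z̄_ν`. -/
def bergmanTensor {n : ℕ} (K : (Fin n → ℂ) → (Fin n → ℂ) → ℂ) (μ ν : Fin n)
    (z : Fin n → ℂ) : ℂ :=
  wderiv μ (fun w => wderivBar ν (fun u => Complex.log (K u u)) w) z

/-- The hermitian quadratic form of the Bergman metric. -/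
def bergmanQuad {n : ℕ} (K : (Fin n → ℂ) → (Fin n → ℂ) → ℂ) (z ξ : Fin n → ℂ) : ℝ :=
  (∑ μ, ∑ ν, bergmanTensor K μ ν z * ξ μ * (starRingEnd ℂ) (ξ ν)).re

/-- The Bergman metric `b_Ω(z,ξ)`. -/
def bergmanMetric {n : ℕ} (K : (Fin n → ℂ) → (Fin n → ℂ) → ℂ) (z ξ : Fin n → ℂ) : ℝ :=
  Real.sqrt (bergmanQuad K z ξ)

/-- Piecewise-`C¹` curves on `[0,1]`. -/
def PiecewiseC1 {n : ℕ} (γ : ℝ → (Fin n → ℂ)) : Prop :=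
  ContinuousOn γ (Set.Icc 0 1) ∧
  ∃ (k : ℕ) (t : Fin (k + 1) → ℝ), StrictMono t ∧ t 0 = 0 ∧ t (Fin.last k) = 1 ∧
    ∀ i : Fin k, ContDiffOn ℝ 1 γ (Set.Icc (t i.castSucc) (t i.succ))

/-- The Bergman length of a curve. -/
def bergmanLength {n : ℕ} (K : (Fin n → ℂ) → (Fin n → ℂ) → ℂ) (γ : ℝ → (Fin n → ℂ)) : ℝ :=
  ∫ t in (0:ℝ)..1, bergmanMetric K (γ t) (deriv γ t)

/-- The Bergman pseudodistance of `Ω`. -/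
def bergmanDist {n : ℕ} (Ω : Set (Fin n → ℂ)) (K : (Fin n → ℂ) → (Fin n → ℂ) → ℂ)
    (z w : Fin n → ℂ) : ℝ :=
  sInf { L : ℝ | ∃ γ : ℝ → (Fin n → ℂ), γ 0 = z ∧ γ 1 = w ∧
    (∀ t ∈ Set.Icc (0:ℝ) 1, γ t ∈ Ω) ∧ PiecewiseC1 γ ∧ L = bergmanLength K γ }

/-- The Bergman ball `B_Ω(p,r)`. -/
def bergmanBall {n : ℕ} (Ω : Set (Fin n → ℂ)) (K : (Fin n → ℂ) → (Fin n → ℂ) → ℂ)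
    (p : Fin n → ℂ) (r : ℝ) : Set (Fin n → ℂ) :=
  { z ∈ Ω | bergmanDist Ω K p z < r }

/-- The Bergman pseudodistance is an honest distance. -/
def BergmanDistIsDistance {n : ℕ} (Ω : Set (Fin n → ℂ))
    (K : (Fin n → ℂ) → (Fin n → ℂ) → ℂ) : Prop :=
  ∀ z ∈ Ω, ∀ w ∈ Ω, z ≠ w → 0 < bergmanDist Ω K z w

/-- `Ω` is complete with respect to the Bergman distance. -/
def BergmanComplete {n : ℕ} (Ω : Set (Fin n → ℂ))
    (K : (Fin n → ℂ) → (Fin n → ℂ) → ℂ) : Prop :=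
  ∀ x : ℕ → (Fin n → ℂ), (∀ k, x k ∈ Ω) →
    (∀ ε : ℝ, 0 < ε → ∃ N, ∀ k ≥ N, ∀ l ≥ N, bergmanDist Ω K (x k) (x l) < ε) →
    ∃ p ∈ Ω, Filter.Tendsto (fun k => bergmanDist Ω K (x k) p) Filter.atTop (nhds 0)

/-- The Euclidean unit ball `𝔹ⁿ ⊂ ℂⁿ`. -/
def euclUnitBall (n : ℕ) : Set (Fin n → ℂ) :=
  { z | ∑ μ, ‖z μ‖ ^ 2 < 1 }

/-- The Bergman–Fridman invariant `h_X(p)`. -/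
def fridmanInv {n : ℕ} (Ω : Set (Fin n → ℂ)) (K : (Fin n → ℂ) → (Fin n → ℂ) → ℂ)
    (p : Fin n → ℂ) : ℝ :=
  sInf { c : ℝ | ∃ r : ℝ, 0 < r ∧ c = 1 / r ∧ ∃ f : (Fin n → ℂ) → (Fin n → ℂ),
    DifferentiableOn ℂ f (euclUnitBall n) ∧ Set.InjOn f (euclUnitBall n) ∧
    f '' euclUnitBall n ⊆ Ω ∧ bergmanBall Ω K p r ⊆ f '' euclUnitBall n }

/-- Biholomorphic equivalence of domains in `ℂⁿ` (an injective holomorphic map of `ℂⁿ`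
restricted to a domain is automatically a biholomorphism onto its image). -/
def Biholomorphic {n : ℕ} (U V : Set (Fin n → ℂ)) : Prop :=
  ∃ f : (Fin n → ℂ) → (Fin n → ℂ),
    DifferentiableOn ℂ f U ∧ Set.InjOn f U ∧ f '' U = V

/-- The Levi form of a real-valued function `ρ` at `p` in direction `ξ`. -/
def leviForm {n : ℕ} (ρ : (Fin n → ℂ) → ℝ) (p ξ : Fin n → ℂ) : ℝ :=
  (∑ μ, ∑ ν, wderiv μ (fun w => wderivBar ν (fun u => (ρ u : ℂ)) w) p
      * ξ μ * (starRingEnd ℂ) (ξ ν)).re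

/-- The complex tangent space of `{ρ = 0}` at `p`. -/
def complexTangent {n : ℕ} (ρ : (Fin n → ℂ) → ℝ) (p : Fin n → ℂ) : Set (Fin n → ℂ) :=
  { ξ | ∑ μ, wderiv μ (fun u => (ρ u : ℂ)) p * ξ μ = 0 }

/-- Strong pseudoconvexity at a boundary point, for defining function `ρ`. -/
def StronglyPseudoconvexAt {n : ℕ} (ρ : (Fin n → ℂ) → ℝ) (p : Fin n → ℂ) : Prop :=
  ∀ ξ ∈ complexTangent ρ p, ξ ≠ 0 → 0 < leviForm ρ p ξ

/-- `ρ` is a (global) defining function for `D`. -/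
def IsDefiningFunction {n : ℕ} (D : Set (Fin n → ℂ)) (ρ : (Fin n → ℂ) → ℝ) : Prop :=
  (∀ z, z ∈ D ↔ ρ z < 0) ∧ ∀ z ∈ frontier D, fderiv ℝ ρ z ≠ 0

/-- Plurisubharmonicity via the sub-mean-value property on complex lines. -/
def PlurisubharmonicOn {n : ℕ} (u : (Fin n → ℂ) → ℝ) (Ω : Set (Fin n → ℂ)) : Prop :=
  UpperSemicontinuousOn u Ω ∧
  ∀ (a b : Fin n → ℂ) (r : ℝ), 0 < r →
    (∀ w : ℂ, ‖w‖ ≤ r → a + w • b ∈ Ω) →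
    u a ≤ (1 / (2 * Real.pi)) *
      ∫ θ in (0:ℝ)..(2 * Real.pi), u (a + ((r : ℂ) * Complex.exp (θ * Complex.I)) • b)

/-- Pseudoconvexity: `-log dist(·, ∂D)` is plurisubharmonic on `D`. -/
def IsPseudoconvex {n : ℕ} (D : Set (Fin n → ℂ)) : Prop :=
  PlurisubharmonicOn (fun z => -Real.log (Metric.infDist z Dᶜ)) D

/-- Order of vanishing at `0` of a vector-valued map on `ℂ` (`⊤` if it vanishes to
infinite order). -/
def vanishingOrderC {n : ℕ} (f : ℂ → (Fin n → ℂ)) : ℝ≥0∞ :=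
  sInf ((fun m : ℕ => (m : ℝ≥0∞)) '' { m : ℕ | iteratedDeriv m f 0 ≠ 0 })

/-- Order of vanishing at `0` of a real-valued function on `ℂ`. -/
def vanishingOrderR (g : ℂ → ℝ) : ℝ≥0∞ :=
  sInf ((fun m : ℕ => (m : ℝ≥0∞)) '' { m : ℕ | iteratedFDeriv ℝ m g 0 ≠ 0 })

/-- The D'Angelo 1-type of `ρ` at `p`. -/
def dAngeloOneType {n : ℕ} (ρ : (Fin n → ℂ) → ℝ) (p : Fin n → ℂ) : ℝ≥0∞ :=
  ⨆ (φ : ℂ → (Fin n → ℂ)) (_ : AnalyticAt ℂ φ 0) (_ : φ 0 = p)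
    (_ : vanishingOrderC (fun w => φ w - p) ≠ ⊤),
    vanishingOrderR (fun w => ρ (φ w)) / vanishingOrderC (fun w => φ w - p)

/-- The Levi form at `p` has at most one degenerate eigenvalue. -/
def LeviCorankOneAt {n : ℕ} (ρ : (Fin n → ℂ) → ℝ) (p : Fin n → ℂ) : Prop :=
  ∃ V : Submodule ℂ (Fin n → ℂ), n - 2 ≤ Module.finrank ℂ V ∧
    (V : Set (Fin n → ℂ)) ⊆ complexTangent ρ p ∧
    ∀ ξ ∈ V, ξ ≠ 0 → 0 < leviForm ρ p ξ

/-- A bounded smooth pseudoconvex finite-type Levi corank one domain, with defining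
function `ρ`. -/
def IsLeviCorankOneDomain {n : ℕ} (D : Set (Fin n → ℂ)) (ρ : (Fin n → ℂ) → ℝ) : Prop :=
  IsOpen D ∧ IsConnected D ∧ Bornology.IsBounded D ∧ IsPseudoconvex D ∧
  ContDiff ℝ (⊤ : ℕ∞) ρ ∧ IsDefiningFunction D ρ ∧
  (∀ p ∈ frontier D, dAngeloOneType ρ p ≠ ⊤) ∧
  ∀ p ∈ frontier D, LeviCorankOneAt ρ p

/-- The open unit disc in `ℂ`. -/
def openUnitDisc : Set ℂ := Metric.ball 0 1

/-- Tautness of a domain in `ℂⁿ`. -/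
def IsTaut {n : ℕ} (D : Set (Fin n → ℂ)) : Prop :=
  ∀ f : ℕ → ℂ → (Fin n → ℂ),
    (∀ k, DifferentiableOn ℂ (f k) openUnitDisc ∧ f k '' openUnitDisc ⊆ D) →
    ∃ φ : ℕ → ℕ, StrictMono φ ∧
      ((∃ g : ℂ → (Fin n → ℂ), DifferentiableOn ℂ g openUnitDisc ∧ g '' openUnitDisc ⊆ D ∧
          TendstoLocallyUniformlyOn (fun k => f (φ k)) g Filter.atTop openUnitDisc) ∨
        ∀ S : Set ℂ, IsCompact S → S ⊆ openUnitDisc →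
          ∀ L : Set (Fin n → ℂ), IsCompact L → L ⊆ D →
            ∀ᶠ k in Filter.atTop, ∀ w ∈ S, f (φ k) w ∉ L)

/-- Convergence of a sequence of domains in the local Hausdorff sense. -/
def LocalHausdorffConv {n : ℕ} (Ω : ℕ → Set (Fin n → ℂ)) (Ωl : Set (Fin n → ℂ)) : Prop :=
  (∀ S : Set (Fin n → ℂ), IsCompact S → S ⊆ Ωl → ∀ᶠ j in Filter.atTop, S ⊆ Ω j) ∧
  ∀ S : Set (Fin n → ℂ), IsCompact S →
    (∃ j₀ : ℕ, S ⊆ interior (⋂ j, ⋂ (_ : j₀ ≤ j), Ω j)) → S ⊆ Ωl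

/-- A real-valued subharmonic polynomial of degree at most `d` in one complex variable,
containing no harmonic terms. -/
def SubharmonicPolyNoHarm (P : ℂ → ℝ) (d : ℕ) : Prop :=
  (∃ c : Fin (d + 1) → Fin (d + 1) → ℂ,
    (∀ j, c j 0 = 0) ∧ (∀ k, c 0 k = 0) ∧
    ∀ w : ℂ, (P w : ℂ) = ∑ j, ∑ k, c j k * w ^ (j : ℕ) * (starRingEnd ℂ) w ^ (k : ℕ)) ∧
  ∀ w : ℂ, 0 ≤ (wderiv1 (fun u => wderiv1Bar (fun v => (P v : ℂ)) u) w).re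

/-- A strictly subharmonic real polynomial of degree `2` in one complex variable. -/
def StrictlySubharmonicPolyDeg2 (Q : ℂ → ℝ) : Prop :=
  (∃ c : Fin 3 → Fin 3 → ℂ, ∀ w : ℂ,
      (Q w : ℂ) = ∑ j, ∑ k, c j k * w ^ (j : ℕ) * (starRingEnd ℂ) w ^ (k : ℕ)) ∧
  ∀ w : ℂ, 0 < (wderiv1 (fun u => wderiv1Bar (fun v => (Q v : ℂ)) u) w).re

/-- A nontangential cone in `D` with vertex `p0 ∈ ∂D`. -/
def IsNontangentialCone {n : ℕ} (D Γ : Set (Fin n → ℂ)) (p0 : Fin n → ℂ) : Prop :=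
  Γ ⊆ D ∧ p0 ∈ closure Γ ∧
  ∃ C : ℝ, 0 < C ∧ ∀ z ∈ Γ, ‖z - p0‖ ≤ C * Metric.infDist z Dᶜ

/-- The Bergman kernel is positive on the diagonal of `Ω`. -/
def DiagPos {n : ℕ} (Ω : Set (Fin n → ℂ)) (K : (Fin n → ℂ) → (Fin n → ℂ) → ℂ) : Prop :=
  ∀ z ∈ Ω, (K z z).im = 0 ∧ 0 < (K z z).re

/-- The Bergman metric of `Ω` is positive definite. -/
def BergPosDef {n : ℕ} (Ω : Set (Fin n → ℂ)) (K : (Fin n → ℂ) → (Fin n → ℂ) → ℂ) : Prop :=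
  ∀ z ∈ Ω, ∀ ξ : Fin n → ℂ, ξ ≠ 0 → 0 < bergmanMetric K z ξ

/-- The real coordinate directions of `ℂⁿ ≃ ℝ^{2n}`. -/
def realDir {n : ℕ} (μ : Fin (2 * n)) : Fin n → ℂ :=
  Pi.single ⟨(μ : ℕ) / 2, by have := μ.isLt; omega⟩
    (if (μ : ℕ) % 2 = 0 then 1 else Complex.I)

/-- The real coefficients `g̃_{μν}` of the Bergman metric, obtained by polarization. -/
def realTensor {n : ℕ} (K : (Fin n → ℂ) → (Fin n → ℂ) → ℂ) (μ ν : Fin (2 * n))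
    (z : Fin n → ℂ) : ℝ :=
  (bergmanQuad K z (realDir μ + realDir ν) - bergmanQuad K z (realDir μ)
    - bergmanQuad K z (realDir ν)) / 2

/-- The Christoffel symbols `Γ^η_{μν}` of the Bergman metric, in real coordinates. -/
def christoffel {n : ℕ} (K : (Fin n → ℂ) → (Fin n → ℂ) → ℂ) (η μ ν : Fin (2 * n))
    (z : Fin n → ℂ) : ℝ :=
  (1 / 2) * ∑ τ : Fin (2 * n),
    (fderiv ℝ (realTensor K ν τ) z (realDir μ)
      + fderiv ℝ (realTensor K τ μ) z (realDir ν)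
      - fderiv ℝ (realTensor K μ ν) z (realDir τ))
    * (Matrix.of fun a b => realTensor K a b z)⁻¹ τ η

/-- `z0 ∈ ∂D` is a local holomorphic peak point of `D`. -/
def IsLocalPeakPoint {n : ℕ} (D : Set (Fin n → ℂ)) (z0 : Fin n → ℂ) : Prop :=
  ∃ U ∈ nhds z0, ∃ g : (Fin n → ℂ) → ℂ,
    DifferentiableOn ℂ g (U ∩ D) ∧ ContinuousOn g (closure (U ∩ D)) ∧
    g z0 = 1 ∧ ∀ z ∈ closure (U ∩ D), z ≠ z0 → ‖g z‖ < 1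

/-- A real polynomial on `ℂⁿ` containing no pluriharmonic terms. -/
def IsPolyNoPluriharm {n : ℕ} (P : (Fin n → ℂ) → ℝ) : Prop :=
  ∃ (d : ℕ) (c : (Fin n → Fin (d + 1)) → (Fin n → Fin (d + 1)) → ℂ),
    (∀ α β, (∀ j, (β j : ℕ) = 0) → c α β = 0) ∧
    (∀ α β, (∀ j, (α j : ℕ) = 0) → c α β = 0) ∧
    ∀ z, (P z : ℂ) = ∑ α, ∑ β, c α β * (∏ j, z j ^ (α j : ℕ)) *
      ∏ j, (starRingEnd ℂ) (z j) ^ (β j : ℕ)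

section HolomorphicLimits

variable {E F G ι : Type*} [NormedAddCommGroup E] [NormedSpace ℂ E]
  [NormedAddCommGroup F] [NormedSpace ℂ F] [NormedAddCommGroup G] [NormedSpace ℂ G]

theorem mapsTo_closedBall_of_norm_le {E F : Type*} [NormedAddCommGroup E] [NormedAddCommGroup F]
    {f : E → F} {c : E} {r M : ℝ} (hr : 0 < r)
    (hM : ∀ y ∈ ball c r, ‖f y‖ ≤ M) : MapsTo f (ball c r) (closedBall (f c) (2 * M)) := by
  intro y hy
  rw [mem_closedBall, dist_eq_norm]
  linarith [norm_sub_le (f y) (f c), hM y hy, hM c (mem_ball_self hr)]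

/-- Cauchy estimate for the Fréchet derivative. -/
theorem norm_fderiv_le_of_norm_le {f : E → F} {c : E} {r M : ℝ} (hr : 0 < r)
    (hf : DifferentiableOn ℂ f (ball c r)) (hM : ∀ y ∈ ball c r, ‖f y‖ ≤ M) :
    ‖fderiv ℂ f c‖ ≤ 2 * M / r :=
  Complex.norm_fderiv_le_div_of_mapsTo_ball hf (mapsTo_closedBall_of_norm_le hr hM) hr

theorem norm_sub_le_of_norm_le {f : E → F} {c x : E} {r M : ℝ} (hr : 0 < r)
    (hf : DifferentiableOn ℂ f (ball c r)) (hM : ∀ y ∈ ball c r, ‖f y‖ ≤ M)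
    (hx : x ∈ ball c r) : ‖f x - f c‖ ≤ 2 * M / r * ‖x - c‖ := by
  simpa [dist_eq_norm] using Complex.dist_le_div_mul_dist_of_mapsTo_ball hf
    (mapsTo_closedBall_of_norm_le hr hM) hx

/-- First order Taylor estimate for bounded holomorphic maps. -/
theorem norm_sub_sub_fderiv_le {f : E → F} {c x : E} {r M : ℝ} (hr : 0 < r)
    (hf : DifferentiableOn ℂ f (ball c r)) (hM : ∀ y ∈ ball c r, ‖f y‖ ≤ M)
    (hx : x ∈ ball c r) :
    ‖f x - f c - fderiv ℂ f c (x - c)‖ ≤ 4 * M * (‖x - c‖ / r) ^ 2 := by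
  have hfc : DifferentiableAt ℂ f c := (hf c (mem_ball_self hr)).differentiableAt (ball_mem_nhds c hr)
  set g : E → F := fun y => f y - fderiv ℂ f c (y - c) with hg
  have hgc : g c = f c := by simp [hg]
  have hgd : DifferentiableOn ℂ g (ball c r) :=
    hf.sub ((fderiv ℂ f c).differentiable.comp (differentiable_id.sub_const c)).differentiableOn
  have hmaps : MapsTo g (ball c r) (closedBall (g c) (4 * M)) := by
    intro y hy
    rw [mem_closedBall, dist_eq_norm, hgc]
    have h1 : ‖fderiv ℂ f c (y - c)‖ ≤ 2 * M := by
      have hy' : ‖y - c‖ ≤ r := by rw [← dist_eq_norm]; exact (mem_ball.1 hy).le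
      calc ‖fderiv ℂ f c (y - c)‖ ≤ ‖fderiv ℂ f c‖ * ‖y - c‖ := (fderiv ℂ f c).le_opNorm _
        _ ≤ 2 * M / r * r := by
          gcongr
          · exact (norm_nonneg _).trans (norm_fderiv_le_of_norm_le hr hf hM)
          · exact norm_fderiv_le_of_norm_le hr hf hM
        _ = 2 * M := by field_simp
    have h2 : g y - f c = (f y - f c) - fderiv ℂ f c (y - c) := by simp only [hg]; abel
    rw [h2]
    linarith [norm_sub_le (f y - f c) (fderiv ℂ f c (y - c)), norm_sub_le (f y) (f c),
      hM y hy, hM c (mem_ball_self hr)]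
  have ho : (fun w => g w - g c) =o[𝓝 c] (fun w => ‖w - c‖ ^ 1) := by
    have := hfc.hasFDerivAt.isLittleO
    simp only [pow_one]
    refine (this.norm_right).congr_left fun w => ?_
    simp only [hg, sub_self, map_zero]
    abel
  have := Complex.dist_le_mul_div_pow_of_mapsTo_ball_of_isLittleO hgd hmaps ho hx
  rw [dist_eq_norm, dist_eq_norm, hgc] at this
  have h2 : g x - f c = f x - f c - fderiv ℂ f c (x - c) := by simp only [hg]; abel
  rwa [h2] at this

/-- A family of maps, holomorphic on `U` and locally uniformly bounded there, which converges
pointwise on `U` along an ultrafilter. -/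
structure HolConv (l : Ultrafilter ι) (f : ι → E → F) (g : E → F) (U : Set E) : Prop where
  isOpen : IsOpen U
  diff : ∀ᶠ i in l, DifferentiableOn ℂ (f i) U
  bdd : ∀ x ∈ U, ∃ r > 0, ∃ M : ℝ, ∀ᶠ i in l, ∀ y ∈ ball x r, ‖f i y‖ ≤ M
  lim : ∀ x ∈ U, Tendsto (fun i => f i x) l (𝓝 (g x))

namespace HolConv

variable {l : Ultrafilter ι} {f : ι → E → F} {g : E → F} {U : Set E}

theorem exists_ball (h : HolConv l f g U) {x : E} (hx : x ∈ U) :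
    ∃ r > 0, ∃ M : ℝ, ball x r ⊆ U ∧ ∀ᶠ i in l, DifferentiableOn ℂ (f i) (ball x r) ∧
      ∀ y ∈ ball x r, ‖f i y‖ ≤ M := by
  obtain ⟨r, hr, M, hM⟩ := h.bdd x hx
  obtain ⟨s, hs, hsU⟩ := Metric.isOpen_iff.1 h.isOpen x hx
  refine ⟨min r s, lt_min hr hs, M, (ball_subset_ball (min_le_right _ _)).trans hsU, ?_⟩
  filter_upwards [hM, h.diff] with i hi hd
  exact ⟨hd.mono ((ball_subset_ball (min_le_right _ _)).trans hsU),
    fun y hy => hi y (ball_subset_ball (min_le_left _ _) hy)⟩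

theorem tendsto_comp (h : HolConv l f g U) {x : E} (hx : x ∈ U) {y : ι → E}
    (hy : Tendsto y l (𝓝 x)) : Tendsto (fun i => f i (y i)) l (𝓝 (g x)) := by
  obtain ⟨r, hr, M, -, hM⟩ := h.exists_ball hx
  have h1 : Tendsto (fun i => f i (y i) - f i x) l (𝓝 0) := by
    refine squeeze_zero_norm' (a := fun i => 2 * M / r * ‖y i - x‖) ?_ ?_
    · filter_upwards [hM, hy (ball_mem_nhds x hr)] with i hi hyi
      exact norm_sub_le_of_norm_le hr hi.1 hi.2 hyi
    · have : Tendsto (fun i => ‖y i - x‖) l (𝓝 0) := tendsto_iff_norm_sub_tendsto_zero.1 hy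
      simpa using this.const_mul (2 * M / r)
  simpa using h1.add (h.lim x hx)

theorem exists_hasFDerivAt [FiniteDimensional ℂ E] [FiniteDimensional ℂ F]
    (h : HolConv l f g U) {x : E} (hx : x ∈ U) :
    ∃ L : E →L[ℂ] F, HasFDerivAt g L x ∧ Tendsto (fun i => fderiv ℂ (f i) x) l (𝓝 L) := by
  obtain ⟨r, hr, M, hrU, hM⟩ := h.exists_ball hx
  have : FiniteDimensional ℂ (E →L[ℂ] F) := inferInstance
  have : ProperSpace (E →L[ℂ] F) := FiniteDimensional.proper ℂ _
  have hmem : ∀ᶠ i in l, fderiv ℂ (f i) x ∈ closedBall (0 : E →L[ℂ] F) (2 * M / r) := by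
    filter_upwards [hM] with i hi
    simpa using norm_fderiv_le_of_norm_le hr hi.1 hi.2
  obtain ⟨L, -, hL⟩ := (isCompact_closedBall (0 : E →L[ℂ] F) (2 * M / r)).ultrafilter_le_nhds
    (l.map fun i => fderiv ℂ (f i) x) (le_principal_iff.2 hmem)
  have hL' : Tendsto (fun i => fderiv ℂ (f i) x) l (𝓝 L) := hL
  refine ⟨L, ?_, hL'⟩
  have key : ∀ y ∈ ball x r, ‖g y - g x - L (y - x)‖ ≤ 4 * M * (‖y - x‖ / r) ^ 2 := by
    intro y hy
    have h1 : Tendsto (fun i => f i y - f i x - fderiv ℂ (f i) x (y - x)) l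
        (𝓝 (g y - g x - L (y - x))) :=
      ((h.lim y (hrU hy)).sub (h.lim x hx)).sub
        (((ContinuousLinearMap.apply ℂ F (y - x)).continuous.tendsto L).comp hL')
    refine le_of_tendsto h1.norm ?_
    filter_upwards [hM] with i hi
    exact norm_sub_sub_fderiv_le hr hi.1 hi.2 hy
  rw [hasFDerivAt_iff_isLittleO_nhds_zero]
  have hO : (fun v : E => g (x + v) - g x - L v) =O[𝓝 0] fun v => ‖v‖ ^ 2 := by
    refine Asymptotics.IsBigO.of_bound (4 * M / r ^ 2) ?_
    filter_upwards [ball_mem_nhds (0 : E) hr] with v hv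
    have := key (x + v) (by simpa using hv)
    simp only [add_sub_cancel_left] at this
    refine this.trans (le_of_eq ?_)
    rw [norm_pow, norm_norm]
    field_simp
  refine hO.trans_isLittleO ?_
  have := (Asymptotics.isLittleO_norm_pow_id (E' := E) (one_lt_two))
  exact this

theorem differentiableOn [FiniteDimensional ℂ E] [FiniteDimensional ℂ F]
    (h : HolConv l f g U) : DifferentiableOn ℂ g U := fun _ hx =>
  (h.exists_hasFDerivAt hx).choose_spec.1.differentiableAt.differentiableWithinAt

theorem tendsto_fderiv [FiniteDimensional ℂ E] [FiniteDimensional ℂ F]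
    (h : HolConv l f g U) {x : E} (hx : x ∈ U) :
    Tendsto (fun i => fderiv ℂ (f i) x) l (𝓝 (fderiv ℂ g x)) := by
  obtain ⟨L, hL, hlim⟩ := h.exists_hasFDerivAt hx
  rwa [hL.fderiv]

end HolConv

/-- A map into `E →L[ℂ] F` is holomorphic if it is so after evaluation at every vector. -/
theorem differentiableOn_clm_of_apply [FiniteDimensional ℂ E] {A : G → E →L[ℂ] F} {U : Set G}
    (h : ∀ v, DifferentiableOn ℂ (fun x => A x v) U) : DifferentiableOn ℂ A U := by
  let d := Module.finrank ℂ E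
  have hd : d = Module.finrank ℂ (Fin d → ℂ) := (Module.finrank_fin_fun ℂ).symm
  let e₁ := ContinuousLinearEquiv.ofFinrankEq hd
  let e₂ := (e₁.arrowCongr (1 : F ≃L[ℂ] F)).trans (ContinuousLinearEquiv.piRing (Fin d))
  rw [← Function.id_comp A, ← e₂.symm_comp_self]
  exact e₂.symm.differentiable.comp_differentiableOn (differentiableOn_pi.mpr fun i => h _)

/-- The derivative of a holomorphic map in several variables is holomorphic. -/
theorem DifferentiableOn.fderiv_holomorphic [FiniteDimensional ℂ E] [FiniteDimensional ℂ F]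
    {f : E → F} {U : Set E} (hU : IsOpen U) (hf : DifferentiableOn ℂ f U) :
    DifferentiableOn ℂ (fderiv ℂ f) U := by
  refine differentiableOn_clm_of_apply fun v => ?_
  intro x hx
  obtain ⟨R, hR, hRU⟩ := Metric.isOpen_iff.1 hU x hx
  have hfx : ContinuousAt f x := (hf.continuousOn).continuousAt (hU.mem_nhds hx)
  obtain ⟨R', hR', hb⟩ := Metric.continuousAt_iff.1 hfx 1 one_pos
  obtain ⟨r, hr, hrR, hrR'⟩ : ∃ r > 0, 3 * r ≤ R ∧ 3 * r ≤ R' :=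
    ⟨min R R' / 3, by positivity, by linarith [min_le_left R R'], by linarith [min_le_right R R']⟩
  set M := ‖f x‖ + 1
  have hM : ∀ y ∈ ball x (3 * r), ‖f y‖ ≤ M := by
    intro y hy
    have := hb (lt_of_lt_of_le (mem_ball.1 hy) hrR')
    rw [dist_eq_norm] at this
    have h2 := norm_sub_norm_le (f y) (f x)
    simp only [M]; linarith
  have hfd : DifferentiableOn ℂ f (ball x (3 * r)) := hf.mono ((ball_subset_ball hrR).trans hRU)
  let l : Ultrafilter ℂ := Ultrafilter.of (𝓝[≠] 0)
  have hl : (l : Filter ℂ) ≤ 𝓝[≠] 0 := Ultrafilter.of_le _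
  have hsmall : ∀ᶠ t : ℂ in l, t ≠ 0 ∧ ‖t • v‖ < r := by
    refine hl ?_
    have h1 : ∀ᶠ t : ℂ in 𝓝 0, ‖t • v‖ < r := by
      have : ContinuousAt (fun t : ℂ => ‖t • v‖) 0 := by fun_prop
      exact this.eventually_lt continuousAt_const (by simpa using hr)
    filter_upwards [self_mem_nhdsWithin, mem_nhdsWithin_of_mem_nhds h1] with t h0 h1
    exact ⟨h0, h1⟩
  have hconv : HolConv l (fun t y => t⁻¹ • (f (y + t • v) - f y)) (fun y => fderiv ℂ f y v)
      (ball x r) := by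
    refine ⟨isOpen_ball, ?_, ?_, ?_⟩
    · filter_upwards [hsmall] with t ht
      refine DifferentiableOn.const_smul (DifferentiableOn.sub ?_ ?_) _
      · refine hfd.comp (by fun_prop) fun y hy => ?_
        rw [mem_ball, dist_eq_norm] at hy ⊢
        have : y + t • v - x = (y - x) + t • v := by abel
        rw [this]
        linarith [norm_add_le (y - x) (t • v)]
      · exact hfd.mono (ball_subset_ball (by linarith))
    · intro y hy
      refine ⟨r, hr, 2 * M / r * ‖v‖, ?_⟩
      filter_upwards [hsmall] with t ht z hz
      have hsub : ball z r ⊆ ball x (3 * r) := by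
        refine ball_subset_ball' ?_
        rw [mem_ball] at hy hz
        linarith [dist_triangle z y x]
      have := norm_sub_le_of_norm_le (x := z + t • v) hr (hfd.mono hsub)
        (fun w hw => hM w (hsub hw)) (by simpa using ht.2)
      rw [add_sub_cancel_left] at this
      have htp : 0 < ‖t‖ := norm_pos_iff.2 ht.1
      rw [norm_smul, norm_inv, inv_mul_le_iff₀ htp]
      refine this.trans (le_of_eq ?_)
      rw [norm_smul]; ring
    · intro y hy
      have hfy : HasFDerivAt f (fderiv ℂ f y) y := by
        refine ((hfd y ?_).differentiableAt (isOpen_ball.mem_nhds ?_)).hasFDerivAt <;>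
        exact ball_subset_ball (by linarith) hy
      have := (hfy.hasLineDerivAt v)
      rw [HasLineDerivAt, hasDerivAt_iff_tendsto_slope_zero] at this
      simp only [zero_add, zero_smul, add_zero] at this
      exact this.mono_left hl
  exact ((hconv.differentiableOn x (mem_ball_self hr)).differentiableAt
    (ball_mem_nhds x hr)).differentiableWithinAt

theorem DifferentiableOn.contDiffAt_holomorphic [FiniteDimensional ℂ E] [FiniteDimensional ℂ F]
    {f : E → F} {U : Set E} (hU : IsOpen U) (hf : DifferentiableOn ℂ f U) {x : E} (hx : x ∈ U) :
    ContDiffAt ℂ 1 f x := by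
  have : ContDiffOn ℂ 1 f U := by
    have := contDiffOn_succ_iff_fderiv_of_isOpen (𝕜 := ℂ) (f := f) (n := 0) hU
    rw [zero_add] at this
    exact this.2 ⟨hf, by simp, contDiffOn_zero.2 (hf.fderiv_holomorphic hU).continuousOn⟩
  exact this.contDiffAt (hU.mem_nhds hx)

namespace HolConv

variable {l : Ultrafilter ι} {f : ι → E → F} {g : E → F} {U : Set E}

theorem fderiv [FiniteDimensional ℂ E] [FiniteDimensional ℂ F] (h : HolConv l f g U) :
    HolConv l (fun i => fderiv ℂ (f i)) (fderiv ℂ g) U where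
  isOpen := h.isOpen
  diff := by
    filter_upwards [h.diff] with i hi using hi.fderiv_holomorphic h.isOpen
  bdd := by
    intro x hx
    obtain ⟨r, hr, M, hrU, hM⟩ := h.exists_ball hx
    refine ⟨r / 2, by positivity, 2 * M / (r / 2), ?_⟩
    filter_upwards [hM] with i hi y hy
    have hsub : ball y (r / 2) ⊆ ball x r := ball_subset_ball' (by linarith [mem_ball.1 hy])
    exact norm_fderiv_le_of_norm_le (by positivity) (hi.1.mono hsub) fun z hz => hi.2 z (hsub hz)
  lim := fun x hx => h.tendsto_fderiv hx

theorem comp_left [FiniteDimensional ℂ F] (h : HolConv l f g U) {φ : F → G}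
    (hφ : Differentiable ℂ φ) : HolConv l (fun i x => φ (f i x)) (fun x => φ (g x)) U where
  isOpen := h.isOpen
  diff := by
    filter_upwards [h.diff] with i hi using hφ.comp_differentiableOn hi
  bdd := by
    intro x hx
    obtain ⟨r, hr, M, hM⟩ := h.bdd x hx
    have : ProperSpace F := FiniteDimensional.proper ℂ F
    obtain ⟨C, hC⟩ := (isCompact_closedBall (0 : F) M).exists_bound_of_continuousOn
      hφ.continuous.continuousOn
    refine ⟨r, hr, C, ?_⟩
    filter_upwards [hM] with i hi y hy using hC _ (by simpa using hi y hy)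
  lim := fun x hx => (hφ.continuous.tendsto _).comp (h.lim x hx)

theorem comp_right (h : HolConv l f g U) {φ : G → E} (hφ : Differentiable ℂ φ) :
    HolConv l (fun i x => f i (φ x)) (fun x => g (φ x)) (φ ⁻¹' U) where
  isOpen := h.isOpen.preimage hφ.continuous
  diff := by
    filter_upwards [h.diff] with i hi using hi.comp hφ.differentiableOn fun x hx => hx
  bdd := by
    intro x hx
    obtain ⟨r, hr, M, hM⟩ := h.bdd (φ x) hx
    obtain ⟨s, hs, hsr⟩ := Metric.continuousAt_iff.1 hφ.continuous.continuousAt r hr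
    refine ⟨s, hs, M, ?_⟩
    filter_upwards [hM] with i hi y hy using hi _ (hsr hy)
  lim := fun x hx => h.lim (φ x) hx

/-- Hurwitz's theorem: a limit of zero-free holomorphic functions which does not vanish on a circle
does not vanish at its centre. -/
theorem ne_zero_of_forall_sphere {l : Ultrafilter ι} {h : ι → ℂ → ℂ} {H : ℂ → ℂ} {U : Set ℂ}
    (hh : HolConv l h H U) {c : ℂ} {r : ℝ} (hr : 0 < r) (hcU : closedBall c r ⊆ U)
    (hne : ∀ᶠ i in l, ∀ z ∈ closedBall c r, h i z ≠ 0) (hH : ∀ z ∈ sphere c r, H z ≠ 0) :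
    H c ≠ 0 := by
  have key : ∀ᶠ i in l, ∃ x ∈ sphere c r, ‖h i x‖ ≤ ‖h i c‖ := by
    filter_upwards [hne, hh.diff] with i hi hd
    have hcont : ContinuousOn (fun z => ‖h i z‖) (sphere c r) :=
      (hd.continuousOn.mono (sphere_subset_closedBall.trans hcU)).norm
    obtain ⟨x, hx, hmin⟩ := (isCompact_sphere c r).exists_isMinOn
      (NormedSpace.sphere_nonempty.2 hr.le) hcont
    refine ⟨x, hx, ?_⟩
    have hx0 : 0 < ‖h i x‖ := norm_pos_iff.2 (hi x (sphere_subset_closedBall hx))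
    have hinv : DifferentiableOn ℂ (fun z => (h i z)⁻¹) (closedBall c r) :=
      (hd.mono hcU).inv hi
    have hdc : DiffContOnCl ℂ (fun z => (h i z)⁻¹) (ball c r) := by
      refine DifferentiableOn.diffContOnCl ?_
      rwa [closure_ball c hr.ne']
    have := Complex.norm_le_of_forall_mem_frontier_norm_le (C := ‖h i x‖⁻¹) isBounded_ball hdc
      (fun z hz => by
        rw [frontier_ball c hr.ne'] at hz
        rw [norm_inv]
        exact inv_anti₀ hx0 (hmin hz)) (subset_closure (mem_ball_self hr))
    rw [norm_inv] at this
    exact (inv_le_inv₀ (norm_pos_iff.2 (hi c (mem_closedBall_self hr.le))) hx0).1 this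
  choose! x hx hle using fun i (hi : ∃ x ∈ sphere c r, ‖h i x‖ ≤ ‖h i c‖) => hi
  obtain ⟨y, hy, hly⟩ := (isCompact_sphere c r).ultrafilter_le_nhds (l.map x)
    (le_principal_iff.2 (key.mono fun i hi => hx i hi))
  have hyU := hcU (sphere_subset_closedBall hy)
  have h1 := (hh.tendsto_comp hyU (y := x) hly).norm
  have h2 := (hh.lim c (hcU (mem_closedBall_self hr.le))).norm
  have h3 : ‖H y‖ ≤ ‖H c‖ := le_of_tendsto_of_tendsto h1 h2 (key.mono fun i hi => hle i hi)
  exact norm_pos_iff.1 ((norm_pos_iff.2 (hH y hy)).trans_le h3)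

end HolConv

end HolomorphicLimits

section Osgood

/-- An injective holomorphic function of one variable has no critical points. -/
theorem deriv_ne_zero_of_injOn_holomorphic {g : ℂ → ℂ} {V : Set ℂ} (hV : IsOpen V)
    (hg : DifferentiableOn ℂ g V) (hinj : InjOn g V) {c : ℂ} (hc : c ∈ V) : deriv g c ≠ 0 := by
  intro hd
  have han : AnalyticAt ℂ g c := hg.analyticAt (hV.mem_nhds hc)
  have han' : AnalyticAt ℂ (fun z => g z - g c) c := han.sub analyticAt_const
  have hne : ¬ ∀ᶠ z in 𝓝 c, g z - g c = 0 := by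
    intro h
    obtain ⟨ε, hε, hb⟩ := Metric.eventually_nhds_iff_ball.1 (h.and (hV.mem_nhds hc))
    have h1 : c + (ε / 2 : ℝ) ∈ ball c ε := by
      rw [mem_ball, dist_eq_norm, add_sub_cancel_left, Complex.norm_real, Real.norm_eq_abs,
        abs_of_pos (half_pos hε)]
      exact half_lt_self hε
    have h2 := hinj (hb _ h1).2 hc (sub_eq_zero.1 (hb _ h1).1)
    simp [hε.ne'] at h2
  obtain ⟨k, u, hu, hu0, heq⟩ := han'.exists_eventuallyEq_pow_smul_nonzero_iff.2 hne
  have hk0 : k ≠ 0 := by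
    rintro rfl
    have := heq.self_of_nhds
    simp at this
    exact hu0 this.symm
  have hk1 : k ≠ 1 := by
    rintro rfl
    have h1 : HasDerivAt (fun z => g z - g c) (u c) c := by
      have h2 : HasDerivAt (fun z => (z - c) * u z) (1 * u c + (c - c) * deriv u c) c :=
        ((hasDerivAt_id c).sub_const c).mul hu.differentiableAt.hasDerivAt
      have h3 : HasDerivAt (fun z => (z - c) * u z) (u c) c := by simpa using h2
      exact h3.congr_of_eventuallyEq (heq.mono fun z hz => by simpa using hz)
    have h4 := (h1.add_const (g c)).deriv
    simp only [sub_add_cancel] at h4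
    exact hu0 (h4.symm.trans hd)
  set w : ℂ → ℂ := fun z => (u z / u c) ^ ((1 : ℂ) / k) with hw
  have hwk : ∀ z, w z ^ k = u z / u c := by
    intro z
    rw [hw]; simp only
    rw [one_div, Complex.cpow_nat_inv_pow _ hk0]
  have hwan : AnalyticAt ℂ w c := by
    refine (hu.div_const).cpow analyticAt_const ?_
    rw [div_self hu0]; exact Complex.one_mem_slitPlane
  have hwc : w c = 1 := by simp [hw, div_self hu0]
  set ψ : ℂ → ℂ := fun z => (z - c) * w z
  have hψan : AnalyticAt ℂ ψ c := (analyticAt_id.sub analyticAt_const).mul hwan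
  have hψd : deriv ψ c = 1 := by
    have h2 : HasDerivAt ψ (1 * w c + (c - c) * deriv w c) c :=
      ((hasDerivAt_id c).sub_const c).mul hwan.differentiableAt.hasDerivAt
    rw [h2.deriv, hwc]; simp
  have hψ : HasStrictDerivAt ψ 1 c := hψd ▸ hψan.hasStrictDerivAt
  have hmap : map ψ (𝓝 c) = 𝓝 0 := by
    rw [hψ.map_nhds_eq one_ne_zero]; simp [ψ]
  have hS : {z | z ∈ V ∧ g z - g c = (z - c) ^ k • u z} ∈ 𝓝 c := inter_mem (hV.mem_nhds hc) heq
  have himg := image_mem_map (m := ψ) hS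
  rw [hmap] at himg
  obtain ⟨δ, hδ, hb⟩ := Metric.mem_nhds_iff.1 himg
  set ζ := Complex.exp (2 * Real.pi * Complex.I / k)
  have hζ : IsPrimitiveRoot ζ k := Complex.isPrimitiveRoot_exp k hk0
  have hζn : ‖ζ‖ = 1 := hζ.norm'_eq_one hk0
  have hδn : ‖((δ / 2 : ℝ) : ℂ)‖ = δ / 2 := by
    rw [Complex.norm_real, Real.norm_eq_abs, abs_of_pos (half_pos hδ)]
  obtain ⟨x, ⟨hxV, hx⟩, hxψ⟩ := hb (show ((δ / 2 : ℝ) : ℂ) ∈ ball 0 δ by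
    rw [mem_ball_zero_iff, hδn]; linarith)
  obtain ⟨y, ⟨hyV, hy⟩, hyψ⟩ := hb (show ((δ / 2 : ℝ) : ℂ) * ζ ∈ ball 0 δ by
    rw [mem_ball_zero_iff, norm_mul, hδn, hζn]; linarith)
  have key : ∀ z, (z - c) ^ k • u z = u c * ψ z ^ k := by
    intro z
    simp only [ψ, mul_pow, hwk, smul_eq_mul]
    field_simp
  rw [key] at hx hy
  have hxy : g x = g y := by
    have : g x - g c = g y - g c := by rw [hx, hy, hxψ, hyψ, mul_pow, hζ.pow_eq_one, mul_one]
    simpa using this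
  have := hinj hxV hyV hxy
  rw [this, hyψ] at hxψ
  have hz1 : ζ = 1 := by
    have h0 : ((δ / 2 : ℝ) : ℂ) ≠ 0 := by
      rw [← norm_pos_iff, hδn]; linarith
    exact mul_left_cancel₀ h0 (by rw [hxψ, mul_one])
  exact hk1 (Nat.dvd_one.1 ((hζ.pow_eq_one_iff_dvd 1).1 (by rw [pow_one, hz1])))

end Osgood

section LocalInverse

variable {E F : Type*} [NormedAddCommGroup E] [NormedSpace ℂ E] [NormedAddCommGroup F]
  [NormedSpace ℂ F] [FiniteDimensional ℂ E] [FiniteDimensional ℂ F]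

theorem exists_equiv_of_injective (hEF : Module.finrank ℂ E = Module.finrank ℂ F)
    {A : E →L[ℂ] F} (hA : Function.Injective A) : ∃ e : E ≃L[ℂ] F, (e : E →L[ℂ] F) = A :=
  ⟨(LinearEquiv.ofInjectiveOfFinrankEq A.toLinearMap hA hEF).toContinuousLinearEquiv, by
    ext x; rfl⟩

theorem isOpen_setOf_injective (hEF : Module.finrank ℂ E = Module.finrank ℂ F) :
    IsOpen {A : E →L[ℂ] F | Function.Injective A} := by
  have : CompleteSpace E := FiniteDimensional.complete ℂ E
  have h : {A : E →L[ℂ] F | Function.Injective A} = range ((↑) : (E ≃L[ℂ] F) → E →L[ℂ] F) := by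
    ext A
    refine ⟨fun hA => exists_equiv_of_injective hEF hA, ?_⟩
    rintro ⟨e, rfl⟩
    exact e.injective
  rw [h]
  exact ContinuousLinearEquiv.isOpen

/-- The holomorphic inverse function theorem. -/
theorem exists_openPartialHomeomorph_of_injective_fderiv
    (hEF : Module.finrank ℂ E = Module.finrank ℂ F) {f : E → F} {U : Set E} (hU : IsOpen U)
    (hf : DifferentiableOn ℂ f U) {x : E} (hx : x ∈ U) (hinj : Function.Injective (fderiv ℂ f x)) :
    ∃ e : OpenPartialHomeomorph E F, ⇑e = f ∧ x ∈ e.source ∧ e.source ⊆ U ∧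
      DifferentiableOn ℂ e.symm e.target := by
  have : CompleteSpace E := FiniteDimensional.complete ℂ E
  obtain ⟨L, hL⟩ := exists_equiv_of_injective hEF hinj
  have hc : ContDiffAt ℂ 1 f x := hf.contDiffAt_holomorphic hU hx
  have hL' : HasFDerivAt f (L : E →L[ℂ] F) x := by
    rw [hL]; exact ((hf x hx).differentiableAt (hU.mem_nhds hx)).hasFDerivAt
  set e₀ := hc.toOpenPartialHomeomorph f hL' one_ne_zero
  set s : Set E := U ∩ fderiv ℂ f ⁻¹' {A | Function.Injective A}
  have hs : IsOpen s := (hf.fderiv_holomorphic hU).continuousOn.isOpen_inter_preimage hU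
    (isOpen_setOf_injective hEF)
  refine ⟨e₀.restrOpen s hs, ?_, ?_, ?_, ?_⟩
  · rfl
  · rw [OpenPartialHomeomorph.restrOpen_source]
    exact ⟨hc.mem_toOpenPartialHomeomorph_source hL' one_ne_zero, hx, hinj⟩
  · rw [OpenPartialHomeomorph.restrOpen_source]
    exact fun y hy => hy.2.1
  · intro y hy
    have hy' := (e₀.restrOpen s hs).map_target hy
    rw [OpenPartialHomeomorph.restrOpen_source] at hy'
    obtain ⟨L', hL'⟩ := exists_equiv_of_injective hEF hy'.2.2
    refine ((e₀.restrOpen s hs).hasFDerivAt_symm (f' := L') hy ?_).differentiableAt.differentiableWithinAt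
    rw [hL']
    exact ((hf _ hy'.2.1).differentiableAt (hU.mem_nhds hy'.2.1)).hasFDerivAt

end LocalInverse

section ZeroCurve

/-- Derivative in the second variable. -/
def sndDeriv (A : ℂ × ℂ → ℂ) (p : ℂ × ℂ) : ℂ := fderiv ℂ A p (0, 1)

theorem sndDeriv_differentiableOn {A : ℂ × ℂ → ℂ} {Ω : Set (ℂ × ℂ)} (hΩ : IsOpen Ω)
    (hA : DifferentiableOn ℂ A Ω) : DifferentiableOn ℂ (sndDeriv A) Ω :=
  (ContinuousLinearMap.apply ℂ ℂ ((0, 1) : ℂ × ℂ)).differentiable.comp_differentiableOn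
    (hA.fderiv_holomorphic hΩ)

theorem sndDeriv_iterate_differentiableOn {A : ℂ × ℂ → ℂ} {Ω : Set (ℂ × ℂ)} (hΩ : IsOpen Ω)
    (hA : DifferentiableOn ℂ A Ω) (k : ℕ) : DifferentiableOn ℂ (sndDeriv^[k] A) Ω := by
  induction k with
  | zero => exact hA
  | succ k ih =>
    rw [Function.iterate_succ_apply']
    exact sndDeriv_differentiableOn hΩ ih

theorem iteratedDeriv_slice_eq {A : ℂ × ℂ → ℂ} {Ω : Set (ℂ × ℂ)} (hΩ : IsOpen Ω)
    (hA : DifferentiableOn ℂ A Ω) (k : ℕ) (s t : ℂ) (h : (s, t) ∈ Ω) :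
    iteratedDeriv k (fun τ => A (s, τ)) t = (sndDeriv^[k] A) (s, t) := by
  induction k generalizing t with
  | zero => simp
  | succ k ih =>
    rw [iteratedDeriv_succ, Function.iterate_succ_apply']
    have hc : Continuous fun τ : ℂ => (s, τ) := by fun_prop
    have hev : iteratedDeriv k (fun τ => A (s, τ)) =ᶠ[𝓝 t] fun τ => (sndDeriv^[k] A) (s, τ) := by
      filter_upwards [(hΩ.preimage hc).mem_nhds h] with τ hτ using ih τ hτ
    rw [hev.deriv_eq]
    have h1 : HasFDerivAt (sndDeriv^[k] A) (fderiv ℂ (sndDeriv^[k] A) (s, t)) (s, t) :=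
      ((sndDeriv_iterate_differentiableOn hΩ hA k _ h).differentiableAt
        (hΩ.mem_nhds h)).hasFDerivAt
    have h2 : HasDerivAt (fun τ : ℂ => (s, τ)) ((0 : ℂ), (1 : ℂ)) t :=
      (hasDerivAt_const t s).prodMk (hasDerivAt_id t)
    exact (h1.comp_hasDerivAt t h2).deriv

theorem eventually_eq_zero_iff_iteratedDeriv {φ : ℂ → ℂ} {t : ℂ} (h : AnalyticAt ℂ φ t) :
    (∀ᶠ τ in 𝓝 t, φ τ = 0) ↔ ∀ k, iteratedDeriv k φ t = 0 := by
  constructor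
  · intro h0 k
    have : φ =ᶠ[𝓝 t] fun _ => 0 := h0
    rw [this.iteratedDeriv_eq]
    simp
  · intro h0
    have := h.hasFPowerSeriesAt
    rw [this.locally_zero_iff]
    ext n
    simp [h0]

/-- Solvability of `A (s, t) = 0` in `t` persists for nearby `s`. -/
theorem eventually_exists_zero {A : ℂ × ℂ → ℂ} {Ω : Set (ℂ × ℂ)} (hΩ : IsOpen Ω)
    (hA : DifferentiableOn ℂ A Ω) {p : ℂ × ℂ} (hp : p ∈ Ω) (hp0 : A p = 0)
    (hne : ¬ ∀ᶠ t in 𝓝 p.2, A (p.1, t) = 0) :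
    ∀ᶠ s in 𝓝 p.1, ∃ t, (s, t) ∈ Ω ∧ A (s, t) = 0 := by
  have hcs : ∀ s : ℂ, Continuous fun τ : ℂ => (s, τ) := fun s => by fun_prop
  have hev : ∀ᶠ q in 𝓝 p, q ∈ Ω ∧ ‖A q‖ < 1 :=
    (hΩ.eventually_mem hp).and (((hA p hp).differentiableAt
      (hΩ.mem_nhds hp)).continuousAt.norm.eventually_lt continuousAt_const (by simp [hp0]))
  obtain ⟨δ, hδ, hb⟩ := Metric.eventually_nhds_iff_ball.1 hev
  rw [show p = (p.1, p.2) from rfl, ← ball_prod_same] at hb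
  have hdiff : ∀ s ∈ ball p.1 δ, DifferentiableOn ℂ (fun t => A (s, t)) (ball p.2 δ) :=
    fun s hs => hA.comp (by fun_prop) fun t ht => (hb (s, t) ⟨hs, ht⟩).1
  have hne' := (((hdiff p.1 (mem_ball_self hδ)).analyticAt
    (ball_mem_nhds _ hδ)).eventually_eq_zero_or_eventually_ne_zero).resolve_left hne
  obtain ⟨ε, hε, hbε⟩ := Metric.eventually_nhds_iff_ball.1 (eventually_nhdsWithin_iff.1 hne')
  obtain ⟨r, hr, hrδ, hrε⟩ : ∃ r > 0, r < δ ∧ r < ε :=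
    ⟨min δ ε / 2, by positivity, by linarith [min_le_left δ ε, lt_min hδ hε],
      by linarith [min_le_right δ ε, lt_min hδ hε]⟩
  by_contra hcon
  have hfr : ∃ᶠ s in 𝓝 p.1, s ∈ {s | ¬ ∃ t, (s, t) ∈ Ω ∧ A (s, t) = 0} :=
    not_eventually.1 hcon
  rw [frequently_mem_iff_neBot] at hfr
  let l : Ultrafilter ℂ := Ultrafilter.of (𝓝 p.1 ⊓ 𝓟 {s | ¬ ∃ t, (s, t) ∈ Ω ∧ A (s, t) = 0})
  have hl : (l : Filter ℂ) ≤ 𝓝 p.1 := (Ultrafilter.of_le _).trans inf_le_left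
  have hl' : ∀ᶠ s in l, ¬ ∃ t, (s, t) ∈ Ω ∧ A (s, t) = 0 :=
    ((Ultrafilter.of_le _).trans inf_le_right) (mem_principal_self _)
  have hlb : ∀ᶠ s in l, s ∈ ball p.1 δ := hl (ball_mem_nhds _ hδ)
  have hconv : HolConv l (fun s t => A (s, t)) (fun t => A (p.1, t)) (ball p.2 δ) := by
    refine ⟨isOpen_ball, hlb.mono fun s hs => hdiff s hs, fun t ht => ?_, fun t ht => ?_⟩
    · obtain ⟨ρ, hρ, hρb⟩ := Metric.isOpen_iff.1 isOpen_ball t ht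
      exact ⟨ρ, hρ, 1, hlb.mono fun s hs y hy => (hb (s, y) ⟨hs, hρb hy⟩).2.le⟩
    · have hΩt := (hb (p.1, t) ⟨mem_ball_self hδ, ht⟩).1
      have h1 : ContinuousAt A (p.1, t) :=
        ((hA _ hΩt).differentiableAt (hΩ.mem_nhds hΩt)).continuousAt
      have h2 : Tendsto (fun s : ℂ => (s, t)) l (𝓝 (p.1, t)) :=
        ((by fun_prop : Continuous fun s : ℂ => (s, t)).tendsto p.1).mono_left hl
      exact h1.tendsto.comp h2
  refine hconv.ne_zero_of_forall_sphere hr (closedBall_subset_ball hrδ) ?_ ?_ hp0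
  · filter_upwards [hl', hlb] with s hs hsb t ht h0
    exact hs ⟨t, (hb (s, t) ⟨hsb, closedBall_subset_ball hrδ ht⟩).1, h0⟩
  · intro t ht
    refine hbε t (closedBall_subset_ball hrε (sphere_subset_closedBall ht)) fun h => ?_
    rw [mem_singleton_iff.1 h, mem_sphere, dist_self] at ht
    exact hr.ne ht

/-- The zero set of a holomorphic function of two variables, not identically zero on the vertical
line through one of its zeros, contains a holomorphic graph. -/
theorem exists_zero_curve {A : ℂ × ℂ → ℂ} {Ω : Set (ℂ × ℂ)} (hΩ : IsOpen Ω)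
    (hA : DifferentiableOn ℂ A Ω) {p₀ : ℂ × ℂ} (hp₀ : p₀ ∈ Ω) (hp₀0 : A p₀ = 0)
    (hne : ¬ ∀ᶠ t in 𝓝 p₀.2, A (p₀.1, t) = 0) :
    ∃ (γ : ℂ → ℂ) (s₀ : ℂ) (ε : ℝ), 0 < ε ∧ DifferentiableOn ℂ γ (ball s₀ ε) ∧
      ∀ s ∈ ball s₀ ε, (s, γ s) ∈ Ω ∧ A (s, γ s) = 0 := by
  have hslice : ∀ p ∈ Ω, AnalyticAt ℂ (fun t => A (p.1, t)) p.2 := fun p hp =>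
    (hA.comp (t := Ω) (s := (fun t => (p.1, t)) ⁻¹' Ω) (f := fun t => (p.1, t)) (by fun_prop)
      fun t ht => ht).analyticAt ((hΩ.preimage (by fun_prop)).mem_nhds hp)
  have hchar : ∀ p ∈ Ω, (∀ᶠ t in 𝓝 p.2, A (p.1, t) = 0) ↔ ∀ k, (sndDeriv^[k] A) p = 0 := by
    intro p hp
    rw [eventually_eq_zero_iff_iteratedDeriv (hslice p hp)]
    exact forall_congr' fun k => by rw [iteratedDeriv_slice_eq hΩ hA k p.1 p.2 hp]
  have hex : ∃ k, ∃ p ∈ Ω, A p = 0 ∧ (sndDeriv^[k] A) p ≠ 0 := by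
    by_contra! hcon
    exact hne ((hchar p₀ hp₀).2 fun k => hcon k p₀ hp₀ hp₀0)
  classical
  obtain ⟨p, hp, hp0, hpk⟩ := Nat.find_spec hex
  have hmin := fun m => Nat.find_min hex (m := m)
  generalize Nat.find hex = k at hpk hmin
  obtain _ | k := k
  · exact absurd hp0 hpk
  set h := sndDeriv^[k] A with hh
  have hhd : DifferentiableOn ℂ h Ω := sndDeriv_iterate_differentiableOn hΩ hA k
  have hhZ : ∀ q ∈ Ω, A q = 0 → h q = 0 := by
    intro q hq hq0
    by_contra hcon
    exact hmin k (Nat.lt_succ_self k) ⟨q, hq, hq0, hcon⟩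
  have hhp : fderiv ℂ h p (0, 1) ≠ 0 := by
    rwa [Function.iterate_succ_apply'] at hpk
  set Ψ : ℂ × ℂ → ℂ × ℂ := fun q => (q.1, h q) with hΨ
  have hΨd : DifferentiableOn ℂ Ψ Ω := differentiableOn_fst.prodMk hhd
  have hΨ' : fderiv ℂ Ψ p = (ContinuousLinearMap.fst ℂ ℂ ℂ).prod (fderiv ℂ h p) :=
    (hasFDerivAt_fst.prodMk ((hhd p hp).differentiableAt (hΩ.mem_nhds hp)).hasFDerivAt).fderiv
  have hΨi : Function.Injective (fderiv ℂ Ψ p) := by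
    rw [injective_iff_map_eq_zero]
    rintro ⟨a, b⟩ hab
    rw [hΨ'] at hab
    simp only [ContinuousLinearMap.prod_apply, ContinuousLinearMap.coe_fst', Prod.mk_eq_zero] at hab
    obtain ⟨rfl, hb⟩ := hab
    have h1 : ((0, b) : ℂ × ℂ) = b • (0, 1) := by simp
    rw [h1, map_smul, smul_eq_zero] at hb
    rw [hb.resolve_right hhp]; rfl
  obtain ⟨e, he, hpe, heΩ, hed⟩ :=
    exists_openPartialHomeomorph_of_injective_fderiv rfl hΩ hΨd hp hΨi
  have hpt : (p.1, (0 : ℂ)) ∈ e.target := by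
    have := e.map_source hpe
    rw [he] at this
    simpa [hΨ, hhZ p hp hp0] using this
  have hlin : Continuous fun s : ℂ => (s, (0 : ℂ)) := by fun_prop
  have hne₁ : ¬ ∀ᶠ t in 𝓝 p.2, A (p.1, t) = 0 := fun h0 => hpk ((hchar p hp).1 h0 _)
  have hev := eventually_exists_zero e.open_source (hA.mono heΩ) hpe hp0 hne₁
  obtain ⟨ε, hε, hb⟩ := Metric.eventually_nhds_iff_ball.1
    (hev.and ((e.open_target.preimage hlin).eventually_mem hpt))
  refine ⟨fun s => (e.symm (s, 0)).2, p.1, ε, hε, ?_, fun s hs => ?_⟩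
  · exact differentiable_snd.comp_differentiableOn
      (hed.comp (by fun_prop) fun s hs => (hb s hs).2)
  · obtain ⟨⟨t, hts, ht0⟩, hst⟩ := hb s hs
    have h1 : e (s, t) = (s, 0) := by rw [he, hΨ]; simp [hhZ _ (heΩ hts) ht0]
    have h2 : e.symm (s, 0) = (s, t) := by rw [← h1, e.left_inv hts]
    simp only [h2]
    exact ⟨heΩ hts, ht0⟩

end ZeroCurve

section OsgoodTheorem

variable {E F : Type*} [NormedAddCommGroup E] [NormedSpace ℂ E] [NormedAddCommGroup F]
  [NormedSpace ℂ F] [FiniteDimensional ℂ E] [FiniteDimensional ℂ F]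

theorem differentiable_clm_det : Differentiable ℂ fun A : E →L[ℂ] E => A.det := by
  let b := Module.finBasis ℂ E
  have h : (fun A : E →L[ℂ] E => A.det) = fun A : E →L[ℂ] E =>
      Matrix.det (LinearMap.toMatrix b b (A : E →ₗ[ℂ] E)) := by
    ext A; exact (LinearMap.det_toMatrix b _).symm
  rw [h]
  simp only [Matrix.det_apply]
  have hent : ∀ i j, Differentiable ℂ fun A : E →L[ℂ] E =>
      LinearMap.toMatrix b b (A : E →ₗ[ℂ] E) i j := by
    intro i j
    simp only [LinearMap.toMatrix_apply]
    have h2 : Differentiable ℂ fun v : E => b.repr v i :=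
      (LinearMap.toContinuousLinearMap (b.coord i)).differentiable
    exact h2.comp (ContinuousLinearMap.apply ℂ E (b j)).differentiable
  refine Differentiable.fun_sum fun σ _ => Differentiable.const_smul ?_ _
  exact fun A => (HasFDerivAt.finsetProd fun i _ => (hent (σ i) i A).hasFDerivAt).differentiableAt

theorem clm_det_ne_zero_iff {A : E →L[ℂ] E} : A.det ≠ 0 ↔ Function.Injective A := by
  have h1 : A.det ≠ 0 ↔ IsUnit (A : E →ₗ[ℂ] E) := by
    rw [← isUnit_iff_ne_zero]; exact LinearMap.isUnit_iff_isUnit_det _ |>.symm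
  rw [h1, LinearMap.isUnit_iff_ker_eq_bot, LinearMap.ker_eq_bot]; rfl

theorem eq_of_fderiv_eq_zero_on_ball {E F : Type*} [NormedAddCommGroup E] [NormedSpace ℂ E]
    [NormedAddCommGroup F] [NormedSpace ℂ F] {f : E → F} {c x : E} {r : ℝ}
    (hf : DifferentiableOn ℂ f (ball c r)) (h0 : ∀ y ∈ ball c r, fderiv ℂ f y = 0)
    (hx : x ∈ ball c r) (hr : 0 < r) : f x = f c := by
  have := (convex_ball c r).norm_image_sub_le_of_norm_fderiv_le (𝕜 := ℂ) (f := f) (C := 0)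
    (fun y hy => (hf y hy).differentiableAt (isOpen_ball.mem_nhds hy))
    (fun y hy => by simp [h0 y hy]) (mem_ball_self hr) hx
  simpa [sub_eq_zero] using this

/-- An injective holomorphic map whose derivative at each point is either injective or zero has no
points of vanishing derivative. -/
theorem fderiv_ne_zero_of_injOn_of_eq_zero_or_injective
    (hEF : Module.finrank ℂ E = Module.finrank ℂ F) [Nontrivial E] {g : E → F} {V : Set E}
    (hV : IsOpen V) (hg : DifferentiableOn ℂ g V) (hinj : InjOn g V)
    (halt : ∀ ν ∈ V, fderiv ℂ g ν = 0 ∨ Function.Injective (fderiv ℂ g ν)) {ν₀ : E}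
    (hν₀ : ν₀ ∈ V) : fderiv ℂ g ν₀ ≠ 0 := by
  intro h0
  have hgd : ∀ ν ∈ V, HasFDerivAt g (fderiv ℂ g ν) ν := fun ν hν =>
    ((hg ν hν).differentiableAt (hV.mem_nhds hν)).hasFDerivAt
  have hpos : 0 < Module.finrank ℂ E := Module.finrank_pos
  rcases Nat.lt_or_ge 1 (Module.finrank ℂ E) with h1 | h1
  · let e : F ≃L[ℂ] E := ContinuousLinearEquiv.ofFinrankEq hEF.symm
    set J : E → ℂ := fun ν => ((e : F →L[ℂ] E).comp (fderiv ℂ g ν)).det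
    have hJd : DifferentiableOn ℂ J V := (differentiable_clm_det (E := E)).comp_differentiableOn
      (f := fun ν => (e : F →L[ℂ] E).comp (fderiv ℂ g ν)) (((ContinuousLinearMap.compL ℂ E F E (e : F →L[ℂ] E)).differentiable).comp_differentiableOn
        (hg.fderiv_holomorphic hV))
    have hJ : ∀ ν, J ν ≠ 0 ↔ Function.Injective (fderiv ℂ g ν) := by
      intro ν
      rw [clm_det_ne_zero_iff]
      exact e.injective.of_comp_iff _
    have hJ0 : ∀ ν ∈ V, J ν = 0 → fderiv ℂ g ν = 0 := fun ν hν h =>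
      (halt ν hν).resolve_right fun h' => (hJ ν).2 h' h
    have hJν₀ : J ν₀ = 0 := by
      by_contra h
      have := (hJ ν₀).1 h
      obtain ⟨v, hv⟩ := exists_ne (0 : E)
      exact hv (this (by simp [h0]))
    obtain ⟨ρ, hρ, hρV⟩ := Metric.isOpen_iff.1 hV ν₀ hν₀
    obtain ⟨ν₁, hν₁, hJν₁⟩ : ∃ ν₁ ∈ ball ν₀ ρ, J ν₁ ≠ 0 := by
      by_contra! hcon
      obtain ⟨v, hv⟩ := exists_ne (0 : E)
      have hmem : ν₀ + ((ρ / 2 / ‖v‖ : ℝ) : ℂ) • v ∈ ball ν₀ ρ := by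
        rw [mem_ball, dist_eq_norm, add_sub_cancel_left, norm_smul, Complex.norm_real,
          Real.norm_eq_abs, abs_of_pos (by positivity), div_mul_cancel₀ _ (norm_ne_zero_iff.2 hv)]
        linarith
      have := hinj (hρV hmem) hν₀ (eq_of_fderiv_eq_zero_on_ball (hg.mono hρV)
        (fun y hy => hJ0 y (hρV hy) (hcon y hy)) hmem hρ)
      simp [hv, hρ.ne'] at this
    set v := ν₁ - ν₀ with hv
    have hv0 : v ≠ 0 := by
      intro h
      rw [hv, sub_eq_zero] at h
      exact hJν₁ (h ▸ hJν₀)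
    obtain ⟨w, hw⟩ := exists_linearIndependent_pair_of_one_lt_finrank h1 hv0
    set θ : ℂ × ℂ → E := fun q => ν₀ + q.1 • w + q.2 • v with hθ
    have hθd : Differentiable ℂ θ := by fun_prop
    have hΩ : IsOpen (θ ⁻¹' V) := hV.preimage hθd.continuous
    have hAd : DifferentiableOn ℂ (fun q => J (θ q)) (θ ⁻¹' V) :=
      hJd.comp hθd.differentiableOn fun q hq => hq
    obtain ⟨γ, s₀, ε, hε, hγd, hγ⟩ := exists_zero_curve hΩ hAd (p₀ := 0)
      (by simpa [hθ] using hν₀) (by simpa [hθ] using hJν₀) (by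
        intro hcon
        have hline : Differentiable ℂ fun t : ℂ => ν₀ + t • v := by fun_prop
        have han : AnalyticOnNhd ℂ (fun t : ℂ => J (ν₀ + t • v))
            ((fun t : ℂ => ν₀ + t • v) ⁻¹' ball ν₀ ρ) :=
          ((hJd.mono hρV).comp hline.differentiableOn fun t ht => ht).analyticOnNhd
            (isOpen_ball.preimage hline.continuous)
        have hset : (fun t : ℂ => ν₀ + t • v) ⁻¹' ball ν₀ ρ = ball 0 (ρ / ‖v‖) := by
          ext t
          simp only [mem_preimage, mem_ball, dist_eq_norm, add_sub_cancel_left, sub_zero, norm_smul]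
          rw [lt_div_iff₀ (norm_pos_iff.2 hv0)]
        have hpre : IsPreconnected ((fun t : ℂ => ν₀ + t • v) ⁻¹' ball ν₀ ρ) := by
          rw [hset]; exact (convex_ball _ _).isPreconnected
        have := han.eqOn_zero_of_preconnected_of_eventuallyEq_zero hpre (z₀ := 0)
          (by simpa using hρ) (show ∀ᶠ t in 𝓝 0, J (ν₀ + t • v) = 0 by simpa [hθ] using hcon) (x := 1)
          (by simpa [hv] using hν₁)
        exact hJν₁ (by simpa [hv] using this))
    set Θ : ℂ → E := fun s => θ (s, γ s) with hΘ
    have hΘd : DifferentiableOn ℂ Θ (ball s₀ ε) :=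
      hθd.comp_differentiableOn (differentiableOn_id.prodMk hγd)
    have hconst : ∀ s ∈ ball s₀ ε, g (Θ s) = g (Θ s₀) := by
      intro s hs
      refine eq_of_fderiv_eq_zero_on_ball (f := fun s => g (Θ s))
        (hg.comp hΘd fun s hs => (hγ s hs).1) (fun y hy => ?_) hs hε
      have h2 := (hgd _ (hγ y hy).1)
      rw [hJ0 _ (hγ y hy).1 (hγ y hy).2] at h2
      have h3 := h2.comp y ((hΘd y hy).differentiableAt (isOpen_ball.mem_nhds hy)).hasFDerivAt
      rw [ContinuousLinearMap.zero_comp] at h3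
      exact h3.fderiv
    have hs : s₀ + (ε / 2 : ℝ) ∈ ball s₀ ε := by
      rw [mem_ball, dist_eq_norm, add_sub_cancel_left, Complex.norm_real, Real.norm_eq_abs,
        abs_of_pos (half_pos hε)]
      exact half_lt_self hε
    have h4 := hinj (hγ _ hs).1 (hγ _ (mem_ball_self hε)).1 (hconst _ hs)
    have h5 : (γ (s₀ + (ε / 2 : ℝ)) - γ s₀) • v + ((ε / 2 : ℝ) : ℂ) • w = 0 := by
      simp only [hθ] at h4
      have : ν₀ + (s₀ + ((ε / 2 : ℝ) : ℂ)) • w + γ (s₀ + (ε / 2 : ℝ)) • v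
        - (ν₀ + s₀ • w + γ s₀ • v) = 0 := sub_eq_zero.2 h4
      rw [← this]; module
    have h6 := (LinearIndependent.pair_iff.1 hw _ _ h5).2
    simp [hε.ne'] at h6
  · have hE1 : Module.finrank ℂ E = 1 := by omega
    let e : ℂ ≃L[ℂ] E := ContinuousLinearEquiv.ofFinrankEq (by simp [hE1])
    let e' : F ≃L[ℂ] ℂ := ContinuousLinearEquiv.ofFinrankEq (by simp [← hEF, hE1])
    refine deriv_ne_zero_of_injOn_holomorphic (g := fun t => e' (g (e t))) (V := e ⁻¹' V)
      (hV.preimage e.continuous)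
      (e'.differentiable.comp_differentiableOn
        (hg.comp e.differentiable.differentiableOn fun t ht => ht))
      (fun s hs t ht h => e.injective (hinj hs ht (e'.injective h))) (c := e.symm ν₀)
      (by simpa using hν₀) ?_
    have h2 : HasFDerivAt g (0 : E →L[ℂ] F) (e (e.symm ν₀)) := by
      rw [e.apply_symm_apply, ← h0]; exact hgd _ hν₀
    have h3 := (e'.hasFDerivAt.comp _ (h2.comp _ e.hasFDerivAt)).hasDerivAt.deriv
    exact h3.trans (by simp)

/-- **Osgood's theorem**: an injective holomorphic map between spaces of the same dimension has
injective derivative at every point. -/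
theorem injective_fderiv_of_injOn_holomorphic
    (hEF : Module.finrank ℂ E = Module.finrank ℂ F) {f : E → F} {U : Set E} (hU : IsOpen U)
    (hf : DifferentiableOn ℂ f U) (hinj : InjOn f U) {x : E} (hx : x ∈ U) :
    Function.Injective (fderiv ℂ f x) := by
  by_contra hcon
  have hfd : ∀ x ∈ U, HasFDerivAt f (fderiv ℂ f x) x := fun x hx =>
    ((hf x hx).differentiableAt (hU.mem_nhds hx)).hasFDerivAt
  have hex : ∃ d, ∃ p ∈ U, ¬ Function.Injective (fderiv ℂ f p) ∧
      Module.finrank ℂ (LinearMap.ker (fderiv ℂ f p).toLinearMap) = d := ⟨_, x, hx, hcon, rfl⟩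
  classical
  obtain ⟨p, hp, hpi, hpd⟩ := Nat.find_spec hex
  have hmin : ∀ y ∈ U, ¬ Function.Injective (fderiv ℂ f y) →
      Nat.find hex ≤ Module.finrank ℂ (LinearMap.ker (fderiv ℂ f y).toLinearMap) :=
    fun y hy hyi => Nat.find_min' hex ⟨y, hy, hyi, rfl⟩
  rw [← hpd] at hmin
  set N := LinearMap.ker (fderiv ℂ f p).toLinearMap with hN
  set R := LinearMap.range (fderiv ℂ f p).toLinearMap with hR
  have hNbot : N ≠ ⊥ := fun h => hpi (LinearMap.ker_eq_bot.1 h)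
  have : Nontrivial N := Submodule.nontrivial_iff_ne_bot.2 hNbot
  obtain ⟨C, hC⟩ := Submodule.exists_isCompl R
  let Φ : F ≃L[ℂ] R × C := (R.prodEquivOfIsCompl C hC).symm.toContinuousLinearEquiv
  let π : F →L[ℂ] R := (ContinuousLinearMap.fst ℂ R C).comp (Φ : F →L[ℂ] R × C)
  let κ : F →L[ℂ] C := (ContinuousLinearMap.snd ℂ R C).comp (Φ : F →L[ℂ] R × C)
  have hπκ : ∀ y, π y = 0 → κ y = 0 → y = 0 := fun y h1 h2 =>
    Φ.injective ((Prod.ext h1 h2 : Φ y = 0).trans (map_zero Φ).symm)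
  have hκR : ∀ y ∈ R, κ y = 0 := fun y hy =>
    (Submodule.prodEquivOfIsCompl_symm_apply_snd_eq_zero R C hC).2 hy
  obtain ⟨q₀, hq₀⟩ := LinearMap.exists_leftInverse_of_injective N.subtype N.ker_subtype
  let q : E →L[ℂ] N := LinearMap.toContinuousLinearMap q₀
  have hq : ∀ u : N, q u = u := fun u => LinearMap.congr_fun hq₀ u
  have hrn : Module.finrank ℂ R + Module.finrank ℂ N = Module.finrank ℂ E :=
    LinearMap.finrank_range_add_finrank_ker _
  have hNC : Module.finrank ℂ N = Module.finrank ℂ C := by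
    have := Submodule.finrank_add_eq_of_isCompl hC
    omega
  set Ψ : E → R × N := fun x => (π (f x), q x) with hΨ
  have hΨd : DifferentiableOn ℂ Ψ U :=
    (π.differentiable.comp_differentiableOn hf).prodMk q.differentiable.differentiableOn
  have hΨ' : ∀ y ∈ U, HasFDerivAt Ψ ((π.comp (fderiv ℂ f y)).prod q) y := fun y hy =>
    (π.hasFDerivAt.comp y (hfd y hy)).prodMk q.hasFDerivAt
  have hΨi : Function.Injective (fderiv ℂ Ψ p) := by
    rw [(hΨ' p hp).fderiv, injective_iff_map_eq_zero]
    intro u hu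
    simp only [ContinuousLinearMap.prod_apply, ContinuousLinearMap.comp_apply,
      Prod.mk_eq_zero] at hu
    have h1 : fderiv ℂ f p u = 0 := hπκ _ hu.1 (hκR _ ⟨u, rfl⟩)
    have h2 := hq ⟨u, h1⟩
    rw [hu.2] at h2
    exact (congrArg Subtype.val h2).symm
  obtain ⟨e, he, hpe, heU, hed⟩ := exists_openPartialHomeomorph_of_injective_fderiv
    (by rw [Module.finrank_prod]; exact hrn.symm) hU hΨd hp hΨi
  set c := π (f p)
  have hlin : Differentiable ℂ fun ν : N => (c, ν) := by fun_prop
  set V : Set N := (fun ν : N => (c, ν)) ⁻¹' e.target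
  have hV : IsOpen V := e.open_target.preimage hlin.continuous
  set x' : N → E := fun ν => e.symm (c, ν)
  have hx'U : ∀ ν ∈ V, x' ν ∈ U := fun ν hν => heU (e.map_target hν)
  have hΨx : ∀ ν ∈ V, Ψ (x' ν) = (c, ν) := fun ν hν => by
    rw [← he]; exact e.right_inv hν
  have hx'd : DifferentiableOn ℂ x' V := hed.comp hlin.differentiableOn fun ν hν => hν
  set g : N → C := fun ν => κ (f (x' ν))
  have hgd : DifferentiableOn ℂ g V :=
    κ.differentiable.comp_differentiableOn (hf.comp hx'd hx'U)
  have hginj : InjOn g V := by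
    intro ν hν μ hμ h
    have h1 : f (x' ν) = f (x' μ) := by
      rw [← sub_eq_zero]
      refine hπκ _ ?_ ?_
      · rw [map_sub, sub_eq_zero]
        exact (congrArg Prod.fst (hΨx ν hν)).trans (congrArg Prod.fst (hΨx μ hμ)).symm
      · rw [map_sub, sub_eq_zero]; exact h
    have h2 := hinj (hx'U ν hν) (hx'U μ hμ) h1
    have h3 := hΨx ν hν
    rw [h2, hΨx μ hμ] at h3
    exact (congrArg Prod.snd h3).symm
  have hder : ∀ ν ∈ V, ∃ T : N →L[ℂ] E,
      fderiv ℂ g ν = (κ.comp (fderiv ℂ f (x' ν))).comp T ∧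
      (∀ w, π (fderiv ℂ f (x' ν) (T w)) = 0 ∧ q (T w) = w) ∧
      ∀ u, fderiv ℂ f (x' ν) u = 0 → T (q u) = u := by
    intro ν hν
    have hT : HasFDerivAt x' (fderiv ℂ x' ν) ν :=
      ((hx'd ν hν).differentiableAt (hV.mem_nhds hν)).hasFDerivAt
    refine ⟨fderiv ℂ x' ν, (κ.hasFDerivAt.comp ν ((hfd _ (hx'U ν hν)).comp ν hT)).fderiv, ?_, ?_⟩
    · have h1 := (hΨ' _ (hx'U ν hν)).comp ν hT
      have h2 : HasFDerivAt (Ψ ∘ x') ((0 : N →L[ℂ] R).prod (ContinuousLinearMap.id ℂ N)) ν := by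
        refine ((hasFDerivAt_const c ν).prodMk (hasFDerivAt_id ν)).congr_of_eventuallyEq ?_
        filter_upwards [hV.mem_nhds hν] with μ hμ using hΨx μ hμ
      have h3 := h1.unique h2
      intro w
      have h4 := DFunLike.congr_fun h3 w
      exact ⟨congrArg Prod.fst h4, congrArg Prod.snd h4⟩
    · have hS : HasFDerivAt e.symm (fderiv ℂ e.symm (c, ν)) (c, ν) :=
        ((hed _ hν).differentiableAt (e.open_target.mem_nhds hν)).hasFDerivAt
      have h1 : fderiv ℂ x' ν =
          (fderiv ℂ e.symm (c, ν)).comp ((0 : N →L[ℂ] R).prod (ContinuousLinearMap.id ℂ N)) :=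
        (hS.comp ν ((hasFDerivAt_const c ν).prodMk (hasFDerivAt_id ν))).fderiv
      have hS' : HasFDerivAt e.symm (fderiv ℂ e.symm (c, ν)) (Ψ (x' ν)) := by rwa [hΨx ν hν]
      have h2 : HasFDerivAt (e.symm ∘ Ψ) (ContinuousLinearMap.id ℂ E) (x' ν) := by
        refine (hasFDerivAt_id _).congr_of_eventuallyEq ?_
        filter_upwards [e.open_source.mem_nhds (e.map_target hν)] with y hy
        have := e.left_inv hy
        rwa [he] at this
      have h3 := (hS'.comp _ (hΨ' _ (hx'U ν hν))).unique h2
      intro u hu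
      have h4 := DFunLike.congr_fun h3 u
      simp only [ContinuousLinearMap.comp_apply, ContinuousLinearMap.prod_apply, hu, map_zero,
        ContinuousLinearMap.id_apply] at h4
      rw [h1]
      simpa using h4
  have hker : ∀ ν ∈ V, ¬ Function.Injective (fderiv ℂ f (x' ν)) → fderiv ℂ g ν = 0 := by
    intro ν hν hi
    obtain ⟨T, hT, -, hT'⟩ := hder ν hν
    let qk : LinearMap.ker (fderiv ℂ f (x' ν)).toLinearMap →ₗ[ℂ] N := q.toLinearMap.domRestrict _
    have hqk : Function.Injective qk := by
      intro u u' h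
      ext
      rw [← hT' u u.2, ← hT' u' u'.2]
      exact congrArg T h
    have hfr := le_antisymm (LinearMap.finrank_le_finrank_of_injective hqk)
      (hmin _ (hx'U ν hν) hi)
    ext w
    obtain ⟨u, rfl⟩ := (LinearMap.injective_iff_surjective_of_finrank_eq_finrank hfr).1 hqk w
    have h1 : T (qk u) = u := hT' u u.2
    have h2 : fderiv ℂ f (x' ν) u = 0 := u.2
    simp [hT, h1, h2]
  have hν₀ : q p ∈ V := by
    have := e.map_source hpe
    rwa [he] at this
  have hx'p : x' (q p) = p := by
    have := e.left_inv hpe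
    rwa [he] at this
  refine fderiv_ne_zero_of_injOn_of_eq_zero_or_injective hNC hV hgd hginj (fun ν hν => ?_) hν₀
    (hker _ hν₀ (by rwa [hx'p]))
  by_cases hi : Function.Injective (fderiv ℂ f (x' ν))
  · right
    obtain ⟨T, hT, hT', -⟩ := hder ν hν
    rw [hT, injective_iff_map_eq_zero]
    intro w hw
    have h1 := hπκ _ (hT' w).1 hw
    have h2 : T w = 0 := hi (h1.trans (map_zero _).symm)
    rw [← (hT' w).2, h2, map_zero]
  · exact Or.inl (hker ν hν hi)

end OsgoodTheorem

section BallAutomorphism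

variable {E : Type*} [NormedAddCommGroup E] [InnerProductSpace ℂ E]

/-- The involutive automorphism of the unit ball exchanging `0` and `a`. -/
def ballInvolution (a z : E) : E :=
  (1 - inner ℂ a z)⁻¹ •
    ((1 - inner ℂ a z / (1 + √(1 - ‖a‖ ^ 2) : ℝ)) • a - (√(1 - ‖a‖ ^ 2) : ℂ) • z)

theorem ballInvolution_zero (a : E) : ballInvolution a 0 = a := by
  simp [ballInvolution]

theorem one_sub_inner_ne_zero {a z : E} (ha : ‖a‖ < 1) (hz : ‖z‖ < 1) :
    (1 : ℂ) - inner ℂ a z ≠ 0 := by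
  intro h
  have h1 : ‖inner ℂ a z‖ = 1 := by rw [← sub_eq_zero.1 h, norm_one]
  have h2 := norm_inner_le_norm (𝕜 := ℂ) a z
  nlinarith [norm_nonneg a, norm_nonneg z]

theorem norm_ballInvolution_lt_one {a z : E} (ha : ‖a‖ < 1) (hz : ‖z‖ < 1) :
    ‖ballInvolution a z‖ < 1 := by
  have hD := one_sub_inner_ne_zero ha hz
  have hs2 : 0 < 1 - ‖a‖ ^ 2 := by nlinarith [norm_nonneg a]
  rw [ballInvolution]
  set s := √(1 - ‖a‖ ^ 2) with hs
  have hsp : 0 < s := Real.sqrt_pos.2 hs2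
  have hss : s ^ 2 = 1 - ‖a‖ ^ 2 := Real.sq_sqrt hs2.le
  set w : ℂ := inner ℂ a z with hw
  rw [norm_smul, norm_inv, inv_mul_lt_iff₀ (norm_pos_iff.2 hD), mul_one]
  refine lt_of_pow_lt_pow_left₀ 2 (norm_nonneg _) ?_
  rw [@norm_sub_sq ℂ, inner_smul_left, inner_smul_right, ← hw, norm_smul, norm_smul, mul_pow,
    mul_pow, ← Complex.normSq_eq_norm_sq, ← Complex.normSq_eq_norm_sq, ← Complex.normSq_eq_norm_sq]
  have hdiv : w / ((1 + s : ℝ) : ℂ) = ⟨w.re / (1 + s), w.im / (1 + s)⟩ := by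
    apply Complex.ext
    · simp [Complex.div_re, Complex.normSq_apply]; field_simp
    · simp [Complex.div_im, Complex.normSq_apply]; field_simp
  rw [hdiv]
  simp only [Complex.normSq_apply, RCLike.re_to_complex, Complex.mul_re, Complex.mul_im,
    Complex.conj_re, Complex.conj_im,
    Complex.sub_re, Complex.sub_im, Complex.one_re, Complex.one_im, Complex.ofReal_re,
    Complex.ofReal_im]
  have ha2 : ‖a‖ ^ 2 = 1 - s ^ 2 := by linarith
  have key : (1 - w.re) * (1 - w.re) + (0 - w.im) * (0 - w.im) -
      (((1 - w.re / (1 + s)) * (1 - w.re / (1 + s)) + (0 - w.im / (1 + s)) * (0 - w.im / (1 + s)))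
        * (1 - s ^ 2) - 2 * ((1 - w.re / (1 + s)) * (s * w.re) - (-(0 - w.im / (1 + s))) * (s * w.im))
        + s * s * ‖z‖ ^ 2) = s ^ 2 * (1 - ‖z‖ ^ 2) := by
    field_simp
    ring
  rw [ha2]
  have hz2 : 0 < s ^ 2 * (1 - ‖z‖ ^ 2) := by
    have : 0 < 1 - ‖z‖ ^ 2 := by nlinarith [norm_nonneg z]
    positivity
  ring_nf at key hz2 ⊢
  linarith

theorem ballInvolution_ballInvolution {a z : E} (ha : ‖a‖ < 1) (hz : ‖z‖ < 1) :
    ballInvolution a (ballInvolution a z) = z := by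
  have hD := one_sub_inner_ne_zero ha hz
  have hs2 : 0 < 1 - ‖a‖ ^ 2 := by nlinarith [norm_nonneg a]
  have hD' := one_sub_inner_ne_zero ha (norm_ballInvolution_lt_one ha hz)
  have haa : (inner ℂ a a : ℂ) = 1 - (√(1 - ‖a‖ ^ 2) : ℂ) ^ 2 := by
    rw [inner_self_eq_norm_sq_to_K, ← Complex.ofReal_pow √_, Real.sq_sqrt hs2.le]
    push_cast; simp
  have hsp : 0 < √(1 - ‖a‖ ^ 2) := Real.sqrt_pos.2 hs2
  have hsc : (√(1 - ‖a‖ ^ 2) : ℂ) ≠ 0 := by exact_mod_cast hsp.ne'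
  have hsc1 : (1 + √(1 - ‖a‖ ^ 2) : ℂ) ≠ 0 := by
    have : (1 + √(1 - ‖a‖ ^ 2) : ℝ) ≠ 0 := by positivity
    exact_mod_cast this
  have hw' : inner ℂ a (ballInvolution a z) =
      (1 - (√(1 - ‖a‖ ^ 2) : ℂ) ^ 2 - inner ℂ a z) / (1 - inner ℂ a z) := by
    rw [ballInvolution, inner_smul_right, inner_sub_right, inner_smul_right, inner_smul_right, haa]
    push_cast
    field_simp
    ring
  rw [hw'] at hD'
  conv_lhs => rw [ballInvolution, hw', ballInvolution]
  set s : ℂ := (√(1 - ‖a‖ ^ 2) : ℂ)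
  set w : ℂ := inner ℂ a z
  have hD2 : 1 - (1 - s ^ 2 - w) / (1 - w) = s ^ 2 / (1 - w) := by field_simp; ring
  rw [hD2]
  push_cast
  have e1 : (s ^ 2 / (1 - w))⁻¹ * (s * ((1 - w)⁻¹ * s)) = 1 := by field_simp
  have e2 : (s ^ 2 / (1 - w))⁻¹ * ((1 - (1 - s ^ 2 - w) / (1 - w) / (1 + s)) -
      s * ((1 - w)⁻¹ * (1 - w / (1 + s)))) = 0 := by
    field_simp
    ring
  linear_combination (norm := module) e2 • a + e1 • z

theorem differentiableOn_ballInvolution {a : E} (ha : ‖a‖ < 1) :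
    DifferentiableOn ℂ (ballInvolution a) (ball 0 1) := by
  intro z hz
  have hD := one_sub_inner_ne_zero ha (mem_ball_zero_iff.1 hz)
  have hi : DifferentiableAt ℂ (fun z : E => (inner ℂ a z : ℂ)) z :=
    (innerSL ℂ a).differentiableAt
  unfold ballInvolution
  refine DifferentiableAt.differentiableWithinAt ?_
  refine (((differentiableAt_const _).sub hi).inv hD).smul (DifferentiableAt.sub ?_ ?_)
  · exact ((differentiableAt_const _).sub (by simpa only [div_eq_mul_inv] using hi.mul_const _)).smul (differentiableAt_const _)
  · exact differentiableAt_id.const_smul _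

end BallAutomorphism

section BallImages

variable {E : Type*} [NormedAddCommGroup E] [InnerProductSpace ℂ E]

theorem mapsTo_ballInvolution {a : E} (ha : ‖a‖ < 1) :
    MapsTo (ballInvolution a) (ball 0 1) (ball 0 1) := fun z hz => by
  rw [mem_ball_zero_iff] at hz ⊢
  exact norm_ballInvolution_lt_one ha hz

theorem image_ballInvolution {a : E} (ha : ‖a‖ < 1) :
    ballInvolution a '' ball 0 1 = ball 0 1 := by
  refine Subset.antisymm (mapsTo_ballInvolution ha).image_subset fun z hz => ?_
  exact ⟨ballInvolution a z, mapsTo_ballInvolution ha hz,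
    ballInvolution_ballInvolution ha (mem_ball_zero_iff.1 hz)⟩

theorem injOn_ballInvolution {a : E} (ha : ‖a‖ < 1) :
    InjOn (ballInvolution a) (ball 0 1) := fun z hz w hw h => by
  rw [← ballInvolution_ballInvolution ha (mem_ball_zero_iff.1 hz), h,
    ballInvolution_ballInvolution ha (mem_ball_zero_iff.1 hw)]

end BallImages

section LimitMap

variable {E F : Type*} [NormedAddCommGroup E] [NormedSpace ℂ E] [NormedAddCommGroup F]
  [NormedSpace ℂ F] {n : ℕ} {X : Set (Fin n → ℂ)}

/-- In a taut domain a sequence of discs with a common centre has a subsequence which converges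
pointwise to a map into the domain. -/
theorem IsTaut.exists_subseq_tendsto (hX : IsTaut X) {x₀ : Fin n → ℂ} (hx₀ : x₀ ∈ X)
    {h : ℕ → ℂ → Fin n → ℂ} (hd : ∀ k, DifferentiableOn ℂ (h k) (ball 0 1))
    (hm : ∀ k, MapsTo (h k) (ball 0 1) X) (h0 : ∀ k, h k 0 = x₀) :
    ∃ φ : ℕ → ℕ, StrictMono φ ∧ ∃ g : ℂ → Fin n → ℂ, ∀ t ∈ ball (0 : ℂ) 1,
      g t ∈ X ∧ Tendsto (fun k => h (φ k) t) atTop (𝓝 (g t)) := by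
  obtain ⟨φ, hφ, ⟨g, -, hgX, hg⟩ | hdiv⟩ := hX h fun k => ⟨hd k, (hm k).image_subset⟩
  · exact ⟨φ, hφ, g, fun t ht => ⟨hgX ⟨t, ht, rfl⟩, hg.tendsto_at ht⟩⟩
  · obtain ⟨k, hk⟩ := (hdiv {0} isCompact_singleton
      (by simp [openUnitDisc]) {x₀} isCompact_singleton (by simpa using hx₀)).exists
    exact absurd (by simp [h0]) (hk 0 rfl)

theorem mapsTo_smul_ball {a : E} {ρ : ℝ} (hρ : 0 < ρ) (ha : ‖a‖ ≤ ρ) :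
    MapsTo (fun t : ℂ => (t / ρ) • a) (ball 0 1) (ball 0 1) := by
  intro t ht
  rw [mem_ball_zero_iff] at ht ⊢
  rw [norm_smul, norm_div, Complex.norm_real, Real.norm_eq_abs, abs_of_pos hρ, div_mul_eq_mul_div,
    div_lt_one hρ]
  nlinarith [norm_nonneg t, norm_nonneg a]

variable {f : ℕ → E → Fin n → ℂ} {x₀ : Fin n → ℂ}

theorem IsTaut.exists_norm_le (hX : IsTaut X) (hx₀ : x₀ ∈ X)
    (hd : ∀ k, DifferentiableOn ℂ (f k) (ball 0 1)) (hm : ∀ k, MapsTo (f k) (ball 0 1) X)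
    (h0 : ∀ k, f k 0 = x₀) {ρ : ℝ} (hρ : 0 < ρ) (hρ1 : ρ < 1) :
    ∃ M, ∀ k, ∀ a ∈ ball (0 : E) ρ, ‖f k a‖ ≤ M := by
  by_contra! hcon
  choose j a ha hM using fun M : ℕ => hcon M
  have hline := fun M => mapsTo_smul_ball hρ (mem_ball_zero_iff.1 (ha M)).le
  obtain ⟨φ, hφ, g, hg⟩ := hX.exists_subseq_tendsto hx₀ (h := fun M t => f (j M) ((t / ρ : ℂ) • a M))
    (fun M => (hd _).comp (by fun_prop) (hline M)) (fun M => (hm _).comp (hline M))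
    (fun M => by simp [h0])
  have hlim := (hg ρ (by simpa [abs_of_pos hρ] using hρ1)).2.norm
  have hρc : (ρ : ℂ) ≠ 0 := by exact_mod_cast hρ.ne'
  simp only [div_self hρc, one_smul] at hlim
  refine not_tendsto_nhds_of_tendsto_atTop ?_ _ hlim
  refine tendsto_atTop_mono (fun M => (hM (φ M)).le) ?_
  exact tendsto_natCast_atTop_atTop.comp hφ.tendsto_atTop

theorem IsTaut.mem_of_tendsto (hX : IsTaut X) (hx₀ : x₀ ∈ X)
    (hd : ∀ k, DifferentiableOn ℂ (f k) (ball 0 1)) (hm : ∀ k, MapsTo (f k) (ball 0 1) X)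
    (h0 : ∀ k, f k 0 = x₀) {a : E} (ha : a ∈ ball (0 : E) 1) {y : Fin n → ℂ}
    {l : Filter ℕ} [l.NeBot] (hl : l ≤ atTop) (hy : Tendsto (fun k => f k a) l (𝓝 y)) : y ∈ X := by
  have hcl : MapClusterPt y atTop fun k => f k a := hy.mapClusterPt.mono hl
  obtain ⟨ψ, hψ, hψy⟩ := hcl.tendsto_subseq
  obtain ⟨ρ, haρ, hρ1⟩ := exists_between (mem_ball_zero_iff.1 ha)
  have hρ : 0 < ρ := (norm_nonneg a).trans_lt haρ
  have hline := mapsTo_smul_ball hρ haρ.le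
  obtain ⟨φ, hφ, g, hg⟩ := hX.exists_subseq_tendsto hx₀ (h := fun k t => f (ψ k) ((t / ρ : ℂ) • a))
    (fun M => (hd _).comp (by fun_prop) hline) (fun M => (hm _).comp hline)
    (fun M => by simp [h0])
  obtain ⟨hgX, hlim⟩ := hg ρ (by simpa [abs_of_pos hρ] using hρ1)
  have hρc : (ρ : ℂ) ≠ 0 := by exact_mod_cast hρ.ne'
  simp only [div_self hρc, one_smul] at hlim
  rwa [tendsto_nhds_unique (hψy.comp hφ.tendsto_atTop) hlim]

theorem IsTaut.exists_holConv (hX : IsTaut X) (hx₀ : x₀ ∈ X)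
    (hd : ∀ k, DifferentiableOn ℂ (f k) (ball 0 1)) (hm : ∀ k, MapsTo (f k) (ball 0 1) X)
    (h0 : ∀ k, f k 0 = x₀) {l : Ultrafilter ℕ} (hl : (l : Filter ℕ) ≤ atTop) :
    ∃ G : E → Fin n → ℂ, HolConv l f G (ball 0 1) ∧ MapsTo G (ball 0 1) X := by
  have hb : ∀ a ∈ ball (0 : E) 1, ∃ r > 0, ∃ M : ℝ, ∀ k, ∀ y ∈ ball a r, ‖f k y‖ ≤ M := by
    intro a ha
    obtain ⟨ρ, haρ, hρ1⟩ := exists_between (mem_ball_zero_iff.1 ha)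
    obtain ⟨M, hM⟩ := hX.exists_norm_le hx₀ hd hm h0 ((norm_nonneg a).trans_lt haρ) hρ1
    refine ⟨ρ - ‖a‖, sub_pos.2 haρ, M, fun k y hy => hM k y ?_⟩
    rw [mem_ball, dist_eq_norm] at hy
    rw [mem_ball_zero_iff]
    linarith [norm_sub_norm_le y a]
  have hlim : ∀ a ∈ ball (0 : E) 1, ∃ y, Tendsto (fun k => f k a) l (𝓝 y) := by
    intro a ha
    obtain ⟨r, hr, M, hM⟩ := hb a ha
    obtain ⟨y, -, hy⟩ := (isCompact_closedBall (0 : Fin n → ℂ) M).ultrafilter_le_nhds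
      (l.map fun k => f k a) (le_principal_iff.2 (show ∀ᶠ k in (l : Filter ℕ), f k a ∈ closedBall 0 M from
        Eventually.of_forall fun k => by simpa using hM k a (mem_ball_self hr)))
    exact ⟨y, hy⟩
  choose! G hG using hlim
  refine ⟨G, ⟨isOpen_ball, Eventually.of_forall hd, fun a ha => ?_, hG⟩, fun a ha => ?_⟩
  · obtain ⟨r, hr, M, hM⟩ := hb a ha
    exact ⟨r, hr, M, Eventually.of_forall hM⟩
  · exact hX.mem_of_tendsto hx₀ hd hm h0 ha hl (hG a ha)

end LimitMap

section LimitInjective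

variable {E F ι : Type*} [NormedAddCommGroup E] [NormedSpace ℂ E] [NormedAddCommGroup F]
  [NormedSpace ℂ F] [FiniteDimensional ℂ E] [FiniteDimensional ℂ F]

/-- The inverse of an injective holomorphic map is holomorphic. -/
theorem differentiableOn_invFunOn (hEF : Module.finrank ℂ E = Module.finrank ℂ F) {f : E → F}
    {V : Set E} (hV : IsOpen V) (hf : DifferentiableOn ℂ f V) (hinj : InjOn f V) :
    DifferentiableOn ℂ (Function.invFunOn f V) (f '' V) := by
  rintro _ ⟨x, hx, rfl⟩
  obtain ⟨e, he, hxe, heV, hed⟩ := exists_openPartialHomeomorph_of_injective_fderiv hEF hV hf hx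
    (injective_fderiv_of_injOn_holomorphic hEF hV hf hinj hx)
  have ht : e.target ∈ 𝓝 (f x) := by
    have := e.map_source hxe
    rw [he] at this
    exact e.open_target.mem_nhds this
  refine DifferentiableAt.differentiableWithinAt ?_
  refine ((hed _ (mem_of_mem_nhds ht)).differentiableAt ht).congr_of_eventuallyEq ?_
  filter_upwards [ht] with y hy
  have h1 : f (e.symm y) = y := by rw [← he]; exact e.right_inv hy
  have h2 := heV (e.map_target hy)
  have h3 : y ∈ f '' V := ⟨_, h2, h1⟩
  exact hinj (Function.invFunOn_mem h3) h2 ((Function.invFunOn_eq h3).trans h1.symm)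

namespace HolConv

variable {l : Ultrafilter ι} {f : ι → E → F} {G : E → F} {U : Set E}

/-- Near a point where the derivative of the limit is invertible, the limit value is attained by
the maps of the family. -/
theorem eventually_mem_image (hEF : Module.finrank ℂ E = Module.finrank ℂ F)
    (h : HolConv l f G U) {a : E} (ha : a ∈ U) (hA : Function.Injective (_root_.fderiv ℂ G a))
    {ε : ℝ} (hε : 0 < ε) : ∀ᶠ i in l, G a ∈ f i '' closedBall a ε := by
  have : CompleteSpace E := FiniteDimensional.complete ℂ E
  rcases subsingleton_or_nontrivial E with hE | hE
  · have hF : Subsingleton F := by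
      rw [← Module.finrank_zero_iff (R := ℂ), ← hEF]
      exact Module.finrank_zero_of_subsingleton
    exact Eventually.of_forall fun i => ⟨a, mem_closedBall_self hε.le, Subsingleton.elim _ _⟩
  obtain ⟨A, hAe⟩ := exists_equiv_of_injective hEF hA
  obtain ⟨r, hr, M, hrU, hM⟩ := h.exists_ball ha
  obtain ⟨r', hr', M', hrU', hM'⟩ := h.fderiv.exists_ball ha
  have : Nontrivial F := A.injective.nontrivial
  have hpos : 0 < ‖(A.symm : F →L[ℂ] E)‖ := A.symm.norm_pos
  set c : NNReal := ‖(A.symm : F →L[ℂ] E)‖₊⁻¹ / 2 with hc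
  have hc0 : (0 : ℝ) < c := by rw [hc]; push_cast; positivity
  obtain ⟨δ, hδ, hδr, hδr', hδε, hδc⟩ : ∃ δ > 0, δ < r ∧ δ < r' ∧ δ < ε ∧ 2 * |M'| / r' * δ < c / 2 := by
    have h1 : ∀ᶠ δ : ℝ in 𝓝[>] 0, δ < r ∧ δ < r' ∧ δ < ε ∧ 2 * |M'| / r' * δ < c / 2 := by
      refine mem_nhdsWithin_of_mem_nhds ?_
      refine (eventually_lt_nhds hr).and ((eventually_lt_nhds hr').and
        ((eventually_lt_nhds hε).and ?_))
      have : ContinuousAt (fun δ : ℝ => 2 * |M'| / r' * δ) 0 := by fun_prop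
      exact this.eventually_lt continuousAt_const (by simpa using hc0)
    obtain ⟨δ, h2, h3⟩ := (h1.and self_mem_nhdsWithin).exists
    exact ⟨δ, h3, h2⟩
  have hclose : ∀ᶠ i in l, ‖_root_.fderiv ℂ (f i) a - A‖ < c / 2 := by
    have := h.tendsto_fderiv ha
    rw [← hAe, tendsto_iff_norm_sub_tendsto_zero] at this
    exact this.eventually_lt_const (by linarith)
  have hval : ∀ᶠ i in l, dist (G a) (f i a) < c * δ := by
    have := (h.lim a ha)
    rw [tendsto_iff_dist_tendsto_zero] at this
    filter_upwards [this.eventually_lt_const (mul_pos hc0 hδ)] with i hi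
    rwa [dist_comm]
  filter_upwards [hM, hM', hclose, hval] with i hi hi' hic hiv
  have happ : ApproximatesLinearOn (f i) (A : E →L[ℂ] F) (closedBall a δ) c := by
    intro x hx y hy
    refine (convex_closedBall a δ).norm_image_sub_le_of_norm_fderiv_le' (𝕜 := ℂ) (f := f i)
      (fun z hz => ?_) (fun z hz => ?_) hy hx
    · exact (hi.1 z (closedBall_subset_ball hδr hz)).differentiableAt
        (isOpen_ball.mem_nhds (closedBall_subset_ball hδr hz))
    · have h1 := norm_sub_le_of_norm_le hr' hi'.1
        (fun y hy => (hi'.2 y hy).trans (le_abs_self M')) (closedBall_subset_ball hδr' hz)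
      have h2 : 2 * |M'| / r' * ‖z - a‖ ≤ 2 * |M'| / r' * δ := by
        rw [mem_closedBall, dist_eq_norm] at hz
        gcongr
      have h3 : _root_.fderiv ℂ (f i) z - A =
          (_root_.fderiv ℂ (f i) z - _root_.fderiv ℂ (f i) a) + (_root_.fderiv ℂ (f i) a - A) := by abel
      rw [h3]
      refine (norm_add_le _ _).trans ?_
      linarith
  have hsurj := happ.surjOn_closedBall_of_nonlinearRightInverse A.toNonlinearRightInverse hδ.le
    subset_rfl
  obtain ⟨x, hx, hxG⟩ := hsurj (show G a ∈ _ by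
    rw [mem_closedBall]
    refine hiv.le.trans ?_
    gcongr
    have : ((A.toNonlinearRightInverse).nnnorm : ℝ) = ‖(A.symm : F →L[ℂ] E)‖ := rfl
    rw [this, hc]; push_cast
    linarith)
  exact ⟨x, closedBall_subset_closedBall hδε.le hx, hxG⟩

/-- A limit of injective holomorphic maps on a convex set is injective if its derivative is
injective somewhere. -/
theorem injOn (hEF : Module.finrank ℂ E = Module.finrank ℂ F) (h : HolConv l f G U)
    (hU : Convex ℝ U) (hinj : ∀ᶠ i in l, InjOn (f i) U) {c : E} (hc : c ∈ U)
    (hGc : Function.Injective (_root_.fderiv ℂ G c)) : InjOn G U := by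
  have hder : ∀ a ∈ U, Function.Injective (_root_.fderiv ℂ G a) := by
    let e : F ≃L[ℂ] E := ContinuousLinearEquiv.ofFinrankEq hEF.symm
    set D : (E →L[ℂ] F) → ℂ := fun A => ((e : F →L[ℂ] E).comp A).det with hD
    have hDd : Differentiable ℂ D := (differentiable_clm_det (E := E)).comp
      (f := fun A => (e : F →L[ℂ] E).comp A)
      (ContinuousLinearMap.compL ℂ E F E (e : F →L[ℂ] E)).differentiable
    have hDi : ∀ A, D A ≠ 0 ↔ Function.Injective A := fun A => by
      rw [hD, clm_det_ne_zero_iff]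
      exact e.injective.of_comp_iff _
    have hJ := h.fderiv.comp_left hDd
    intro a ha
    rw [← hDi]
    have hline : Differentiable ℂ fun t : ℂ => c + t • (a - c) := by fun_prop
    have hH := hJ.comp_right hline
    set H : ℂ → ℂ := fun t => D (_root_.fderiv ℂ G (c + t • (a - c))) with hHdef
    set V := (fun t : ℂ => c + t • (a - c)) ⁻¹' U with hV
    have hVc : Convex ℝ V := by
      intro s hs t ht α β hα hβ hαβ
      have := hU hs ht hα hβ hαβ
      rw [hV, mem_preimage]
      convert this using 1
      have hc' : c = α • c + β • c := by rw [← add_smul, hαβ, one_smul]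
      simp only [smul_add, add_smul, smul_assoc]
      nth_rewrite 1 [hc']
      abel
    have h1V : (1 : ℂ) ∈ V := by simpa [hV] using ha
    have h0V : (0 : ℂ) ∈ V := by simpa [hV] using hc
    have han : AnalyticOnNhd ℂ H V := hH.differentiableOn.analyticOnNhd hH.isOpen
    have hne : ∀ᶠ t in 𝓝[≠] 1, H t ≠ 0 := by
      refine (han 1 h1V).eventually_eq_zero_or_eventually_ne_zero.resolve_left fun h0 => ?_
      have := han.eqOn_zero_of_preconnected_of_eventuallyEq_zero hVc.isPreconnected h1V h0 h0V
      exact (hDi _).2 hGc (by simpa [hHdef] using this)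
    obtain ⟨ε, hε, hb⟩ := Metric.eventually_nhds_iff_ball.1
      ((eventually_nhdsWithin_iff.1 hne).and (hH.isOpen.eventually_mem h1V))
    have hsub : closedBall (1 : ℂ) (ε / 2) ⊆ ball 1 ε := closedBall_subset_ball (by linarith)
    have := hH.ne_zero_of_forall_sphere (half_pos hε) (fun t ht => (hb t (hsub ht)).2) ?_ ?_
    · simpa [hHdef] using this
    · filter_upwards [hinj, h.diff] with i hi hd t ht
      exact (hDi _).2 (injective_fderiv_of_injOn_holomorphic hEF h.isOpen hd hi (hb t (hsub ht)).2)
    · intro t ht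
      refine (hb t (hsub (sphere_subset_closedBall ht))).1 fun h1 => ?_
      rw [mem_singleton_iff.1 h1, mem_sphere, dist_self] at ht
      linarith
  intro a ha b hb hab
  by_contra hne
  have hd : 0 < dist a b := dist_pos.2 hne
  obtain ⟨ρ₁, hρ₁, h₁⟩ := Metric.isOpen_iff.1 h.isOpen a ha
  obtain ⟨ρ₂, hρ₂, h₂⟩ := Metric.isOpen_iff.1 h.isOpen b hb
  obtain ⟨ε, hε, hε₁, hε₂, hε₃⟩ : ∃ ε > 0, ε < ρ₁ ∧ ε < ρ₂ ∧ 2 * ε < dist a b := by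
    refine ⟨min (min ρ₁ ρ₂) (dist a b) / 3, by positivity, ?_, ?_, ?_⟩ <;>
    have h3 : 0 < min (min ρ₁ ρ₂) (dist a b) := by positivity
    · linarith [min_le_left (min ρ₁ ρ₂) (dist a b), min_le_left ρ₁ ρ₂]
    · linarith [min_le_left (min ρ₁ ρ₂) (dist a b), min_le_right ρ₁ ρ₂]
    · linarith [min_le_right (min ρ₁ ρ₂) (dist a b)]
  obtain ⟨i, hi, ⟨x, hx, hxG⟩, ⟨y, hy, hyG⟩⟩ := (hinj.and
    ((h.eventually_mem_image hEF ha (hder a ha) hε).and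
      (h.eventually_mem_image hEF hb (hder b hb) hε))).exists
  have hxy := hi (h₁ (closedBall_subset_ball hε₁ hx)) (h₂ (closedBall_subset_ball hε₂ hy))
    (by rw [hxG, hyG, hab])
  subst hxy
  rw [mem_closedBall] at hx hy
  linarith [dist_triangle_left a b x]

end HolConv

end LimitInjective

section ExhaustingImages

variable {E : Type*} [NormedAddCommGroup E] [NormedSpace ℂ E] [FiniteDimensional ℂ E] {n : ℕ}

/-- Let `f j` be injective holomorphic maps of the unit ball into a taut domain with `f j 0 = x₀`,
converging to `F`. Along every connected neighbourhood of `x₀` eventually covered by the images,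
the inverse maps converge to a map with values in the unit ball. -/
theorem exists_holConv_inverse (hEn : Module.finrank ℂ E = Module.finrank ℂ (Fin n → ℂ))
    {f : ℕ → E → Fin n → ℂ} (hd : ∀ j, DifferentiableOn ℂ (f j) (ball 0 1))
    (hinj : ∀ j, InjOn (f j) (ball 0 1)) {x₀ : Fin n → ℂ} (h0 : ∀ j, f j 0 = x₀)
    {l : Ultrafilter ℕ} {U : Set (Fin n → ℂ)} (hU : IsOpen U)
    (hUf : ∀ᶠ j in l, U ⊆ f j '' ball 0 1) (hx₀ : x₀ ∈ U) :
    ∃ G : (Fin n → ℂ) → E,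
      HolConv l (fun j => Function.invFunOn (f j) (ball 0 1)) G U ∧ G x₀ = 0 ∧
        ∀ z ∈ U, ‖G z‖ ≤ 1 := by
  have hball : (0 : E) ∈ ball (0 : E) 1 := mem_ball_self one_pos
  have hmem : ∀ z ∈ U, ∀ᶠ j in (l : Filter ℕ),
      Function.invFunOn (f j) (ball 0 1) z ∈ closedBall (0 : E) 1 := fun z hz => by
    filter_upwards [hUf] with j hj
    exact ball_subset_closedBall (Function.invFunOn_mem (hj hz))
  have : ProperSpace E := FiniteDimensional.proper ℂ E
  have hlim : ∀ z ∈ U, ∃ y, y ∈ closedBall (0 : E) 1 ∧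
      Tendsto (fun j => Function.invFunOn (f j) (ball 0 1) z) l (𝓝 y) := fun z hz =>
    (isCompact_closedBall (0 : E) 1).ultrafilter_le_nhds
      (l.map fun j => Function.invFunOn (f j) (ball 0 1) z) (le_principal_iff.2 (hmem z hz))
  choose! G hGmem hG using hlim
  refine ⟨G, ⟨hU, ?_, fun z hz => ?_, hG⟩, ?_, fun z hz => by simpa using hGmem z hz⟩
  · filter_upwards [hUf] with j hj
    exact (differentiableOn_invFunOn hEn isOpen_ball (hd j) (hinj j)).mono hj
  · obtain ⟨r, hr, hrU⟩ := Metric.isOpen_iff.1 hU z hz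
    refine ⟨r, hr, 1, ?_⟩
    filter_upwards [hUf] with j hj y hy
    exact (mem_ball_zero_iff.1 (Function.invFunOn_mem (hj (hrU hy)))).le
  · refine tendsto_nhds_unique (hG x₀ hx₀) (tendsto_const_nhds.congr fun j => ?_)
    have := (hinj j).leftInvOn_invFunOn hball
    rw [h0] at this
    exact this.symm

/-- A sequence of injective holomorphic maps of the unit ball into a taut domain has an injective
limit whose image contains every point which can be joined to the centre inside an open connected
set eventually covered by the images. -/
theorem IsTaut.exists_injOn_subset_image {X : Set (Fin n → ℂ)} (hX : IsTaut X)
    (hEn : Module.finrank ℂ E = Module.finrank ℂ (Fin n → ℂ)) {x₀ : Fin n → ℂ} (hx₀ : x₀ ∈ X)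
    {f : ℕ → E → Fin n → ℂ} (hd : ∀ j, DifferentiableOn ℂ (f j) (ball 0 1))
    (hinj : ∀ j, InjOn (f j) (ball 0 1)) (hm : ∀ j, MapsTo (f j) (ball 0 1) X)
    (h0 : ∀ j, f j 0 = x₀) {S : Set (Fin n → ℂ)} (hS₀ : x₀ ∈ S)
    (hS : ∀ z ∈ S, ∃ U, IsOpen U ∧ IsPreconnected U ∧ x₀ ∈ U ∧ z ∈ U ∧
      ∀ᶠ j in atTop, U ⊆ f j '' ball 0 1) :
    ∃ F : E → Fin n → ℂ, DifferentiableOn ℂ F (ball 0 1) ∧ InjOn F (ball 0 1) ∧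
      MapsTo F (ball 0 1) X ∧ S ⊆ F '' ball 0 1 := by
  have hl : ((hyperfilter ℕ : Ultrafilter ℕ) : Filter ℕ) ≤ atTop := Nat.hyperfilter_le_atTop
  set l : Ultrafilter ℕ := hyperfilter ℕ
  have hball : (0 : E) ∈ ball (0 : E) 1 := mem_ball_self one_pos
  obtain ⟨F, hF, hFX⟩ := hX.exists_holConv hx₀ hd hm h0 hl
  have hder : Function.Injective (fderiv ℂ F 0) := by
    obtain ⟨U, hU, -, hxU, -, hUf⟩ := hS x₀ hS₀
    replace hUf := hl hUf
    obtain ⟨G, hG, -, -⟩ := exists_holConv_inverse hEn hd hinj h0 hU hUf hxU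
    have hF0 : F 0 = x₀ :=
      tendsto_nhds_unique (hF.lim 0 hball) (tendsto_const_nhds.congr fun j => (h0 j).symm)
    have hlim : Tendsto (fun j => (fderiv ℂ (Function.invFunOn (f j) (ball 0 1)) x₀).comp
        (fderiv ℂ (f j) 0)) l (𝓝 ((fderiv ℂ G x₀).comp (fderiv ℂ F 0))) :=
      ((isBoundedBilinearMap_comp (𝕜 := ℂ) (E := E) (F := Fin n → ℂ)
        (G := E)).continuous.tendsto (fderiv ℂ G x₀, fderiv ℂ F 0)).comp
        ((hG.tendsto_fderiv hxU).prodMk_nhds (hF.tendsto_fderiv hball))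
    have hid : ∀ᶠ j in (l : Filter ℕ), (fderiv ℂ (Function.invFunOn (f j) (ball 0 1)) x₀).comp
        (fderiv ℂ (f j) 0) = ContinuousLinearMap.id ℂ E := by
      filter_upwards [hG.diff] with j hj
      have h1 : DifferentiableAt ℂ (f j) 0 := (hd j).differentiableAt (isOpen_ball.mem_nhds hball)
      have h2 : DifferentiableAt ℂ (Function.invFunOn (f j) (ball 0 1)) (f j 0) := by
        rw [h0]; exact hj.differentiableAt (hU.mem_nhds hxU)
      rw [← h0 j, ← fderiv_comp _ h2 h1, ← fderiv_id (𝕜 := ℂ) (x := (0 : E))]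
      refine Filter.EventuallyEq.fderiv_eq ?_
      filter_upwards [isOpen_ball.mem_nhds hball] with z hz
      exact (hinj j).leftInvOn_invFunOn hz
    have hcomp := tendsto_nhds_unique hlim (tendsto_const_nhds.congr' (hid.mono fun _ h => h.symm))
    intro v w hvw
    simpa [hvw] using (congrArg (fun A => A v) hcomp).symm.trans
      ((congrArg (fderiv ℂ G x₀) hvw).trans (congrArg (fun A => A w) hcomp))
  refine ⟨F, hF.differentiableOn, hF.injOn hEn (convex_ball _ _) (Eventually.of_forall hinj) hball
    hder, hFX, fun z hz => ?_⟩
  obtain ⟨U, hU, hUc, hxU, hzU, hUf⟩ := hS z hz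
  replace hUf := hl hUf
  obtain ⟨G, hG, hG0, hG1⟩ := exists_holConv_inverse hEn hd hinj h0 hU hUf hxU
  have hGz : G z ∈ ball (0 : E) 1 := by
    rw [mem_ball_zero_iff]
    refine lt_of_le_of_ne (hG1 z hzU) fun h1 => ?_
    have := Complex.norm_eqOn_of_isPreconnected_of_isMaxOn hUc hU hG.differentiableOn hzU
      (fun w hw => by simpa [h1] using hG1 w hw) hxU
    simp [hG0, h1] at this
  refine ⟨G z, hGz, tendsto_nhds_unique (hF.tendsto_comp hGz (hG.lim z hzU)) ?_⟩
  refine tendsto_const_nhds.congr' ?_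
  filter_upwards [hUf] with j hj
  exact (Function.invFunOn_eq (hj hzU)).symm

end ExhaustingImages

section CurveThroughPoints

variable {V : Type*} [NormedAddCommGroup V] [NormedSpace ℝ V] [CompleteSpace V]

/-- There is a `C¹` curve through any sufficiently fast null sequence. -/
theorem exists_contDiff_curve_through {w : ℕ → V} (hw : ∀ k, ‖w k‖ ≤ (1 / 4) ^ k) :
    ∃ σ : ℝ → V, ContDiff ℝ 1 σ ∧ σ 0 = 0 ∧ ∀ k, σ ((1 / 2) ^ k) = w k := by
  let β : ContDiffBump (1 : ℝ) := ⟨1 / 8, 1 / 4, by norm_num, by norm_num⟩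
  have hβ : ContDiff ℝ 1 β := β.contDiff
  obtain ⟨C, hC⟩ := (hβ.continuous_deriv le_rfl).bounded_above_of_compact_support
    β.hasCompactSupport.deriv
  have hC0 : 0 ≤ C := (norm_nonneg _).trans (hC 0)
  have hsupp : ∀ t : ℝ, 1 / 4 ≤ |t - 1| → β t = 0 := fun t ht =>
    β.zero_of_le_dist (by rwa [Real.dist_eq])
  let u : ℕ → ℝ → V := fun k t => β (2 ^ k * t) • w k
  have hu : ∀ k, ContDiff ℝ 1 (u k) := fun k => by
    have : ContDiff ℝ 1 fun t : ℝ => β (2 ^ k * t) := hβ.comp (by fun_prop)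
    exact this.smul contDiff_const
  have hderiv : ∀ k t, deriv (u k) t = ((2 : ℝ) ^ k * deriv β (2 ^ k * t)) • w k := fun k t => by
    have h1 : HasDerivAt (fun t : ℝ => β (2 ^ k * t)) ((2 : ℝ) ^ k * deriv β (2 ^ k * t)) t := by
      have h2 := ((hβ.differentiable one_ne_zero) (2 ^ k * t)).hasDerivAt
      have h3 : HasDerivAt (fun t : ℝ => (2 : ℝ) ^ k * t) ((2 : ℝ) ^ k) t := by
        simpa using (hasDerivAt_id t).const_mul ((2 : ℝ) ^ k)
      rw [mul_comm]
      exact h2.comp t h3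
    exact (h1.smul_const (w k)).deriv
  refine ⟨fun t => ∑' k, u k t, ?_, ?_, fun j => ?_⟩
  · refine contDiff_tsum (v := fun m k => (1 + C) * (1 / 2) ^ k) (N := 1) hu
      (fun m _ => (summable_geometric_two).mul_left _) fun m k t hm => ?_
    have h4 : ((1 : ℝ) / 4) ^ k = (1 / 2) ^ k * (1 / 2) ^ k := by
      rw [← mul_pow]; norm_num
    have h2 : (2 : ℝ) ^ k * (1 / 2) ^ k = 1 := by rw [← mul_pow]; norm_num
    have hp : (0 : ℝ) < (1 / 2) ^ k := by positivity
    have hp1 : ((1 : ℝ) / 2) ^ k ≤ 1 := pow_le_one₀ (by norm_num) (by norm_num)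
    have hm' : m ≤ 1 := by exact_mod_cast hm
    interval_cases m
    · rw [norm_iteratedFDeriv_zero, norm_smul, Real.norm_eq_abs, abs_of_nonneg β.nonneg]
      calc β (2 ^ k * t) * ‖w k‖ ≤ 1 * (1 / 4) ^ k := by
            gcongr
            · exact β.le_one
            · exact hw k
        _ ≤ (1 + C) * (1 / 2) ^ k := by rw [h4]; nlinarith [mul_nonneg hC0 hp.le]
    · rw [norm_iteratedFDeriv_one, ← norm_deriv_eq_norm_fderiv, hderiv, norm_smul, norm_mul,
        norm_pow, Real.norm_ofNat]
      calc (2 : ℝ) ^ k * ‖deriv β (2 ^ k * t)‖ * ‖w k‖ ≤ 2 ^ k * C * (1 / 4) ^ k := by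
            gcongr
            · exact hC _
            · exact hw k
        _ = C * (1 / 2) ^ k * (2 ^ k * (1 / 2) ^ k) := by rw [h4]; ring
        _ ≤ (1 + C) * (1 / 2) ^ k := by rw [h2]; nlinarith
  · have : ∀ k, u k 0 = 0 := fun k => by
      simp only [u, mul_zero]
      rw [hsupp 0 (by norm_num), zero_smul]
    simp [this]
  · have h0 : ∀ k, k ≠ j → u k ((1 / 2) ^ j) = 0 := fun k hk => by
      simp only [u]
      rw [hsupp, zero_smul]
      rcases hk.lt_or_gt with h | h
      · obtain ⟨d, rfl⟩ := Nat.exists_eq_add_of_lt h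
        have h1 : (2 : ℝ) ^ k * (1 / 2) ^ (k + d + 1) = (1 / 2) ^ d * (1 / 2) := by
          rw [pow_add, pow_add, ← mul_assoc, ← mul_assoc, ← mul_pow]; norm_num
        have h2 : ((1 : ℝ) / 2) ^ d ≤ 1 := pow_le_one₀ (by norm_num) (by norm_num)
        rw [h1, abs_sub_comm]
        exact le_trans (by linarith) (le_abs_self _)
      · obtain ⟨d, rfl⟩ := Nat.exists_eq_add_of_lt h
        have h1 : (2 : ℝ) ^ (j + d + 1) * (1 / 2) ^ j = 2 ^ d * 2 := by
          rw [show (2 : ℝ) ^ (j + d + 1) * (1 / 2) ^ j = (2 ^ j * (1 / 2) ^ j) * (2 ^ d * 2) by ring,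
            ← mul_pow]
          norm_num
        have h2 : (1 : ℝ) ≤ 2 ^ d := one_le_pow₀ (by norm_num)
        rw [h1]
        exact le_trans (by linarith) (le_abs_self _)
    have h1 : (2 : ℝ) ^ j * (1 / 2) ^ j = 1 := by rw [← mul_pow]; norm_num
    refine (tsum_eq_single j h0).trans ?_
    simp only [u]
    rw [h1, β.one_of_mem_closedBall (mem_closedBall_self β.rIn_pos.le), one_smul]

/-- Every closure point of a set is the starting point of a `C¹` curve which meets the set at
arbitrarily small times. -/
theorem exists_contDiff_curve_of_mem_closure {X A : Set V} (hX : IsOpen X) {z : V} (hz : z ∈ X)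
    (hA : z ∈ closure A) :
    ∃ σ : ℝ → V, ContDiff ℝ 1 σ ∧ σ 0 = z ∧ MapsTo σ (Icc 0 1) X ∧ σ 1 ∈ A ∧
      ∃ τ : ℕ → ℝ, (∀ k, τ k ∈ Ioc 0 1) ∧ Tendsto τ atTop (𝓝 0) ∧ ∀ k, σ (τ k) ∈ A := by
  have hy : ∀ k : ℕ, ∃ y ∈ A, ‖y - z‖ ≤ (1 / 4) ^ k := fun k => by
    obtain ⟨y, hy, hyz⟩ := Metric.mem_closure_iff.1 hA ((1 / 4) ^ k) (by positivity)
    rw [dist_comm, dist_eq_norm] at hyz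
    exact ⟨y, hy, hyz.le⟩
  choose y hyA hyz using hy
  obtain ⟨σ, hσ, hσ0, hσy⟩ := exists_contDiff_curve_through hyz
  obtain ⟨δ, hδ, hδX⟩ : ∃ δ > 0, ∀ t ∈ ball (0 : ℝ) δ, z + σ t ∈ X := by
    refine Metric.eventually_nhds_iff_ball.1 ?_
    have : ContinuousAt (fun t => z + σ t) 0 := by have := hσ.continuous; fun_prop
    exact this.eventually_mem (hX.mem_nhds (by simpa [hσ0] using hz))
  obtain ⟨m, hm⟩ := exists_pow_lt_of_lt_one hδ (by norm_num : (1 / 2 : ℝ) < 1)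
  have hpm : (0 : ℝ) < (1 / 2) ^ m := by positivity
  have hval : ∀ k : ℕ, z + σ ((1 / 2) ^ m * (1 / 2) ^ k) ∈ A := fun k => by
    rw [← pow_add, hσy, add_sub_cancel]
    exact hyA _
  refine ⟨fun t => z + σ ((1 / 2) ^ m * t), ?_, by simp [hσ0], fun t ht => hδX _ ?_, ?_,
    fun k => (1 / 2) ^ k, fun k => ⟨by positivity, pow_le_one₀ (by norm_num) (by norm_num)⟩,
    tendsto_pow_atTop_nhds_zero_of_lt_one (by norm_num) (by norm_num), hval⟩
  · exact contDiff_const.add (hσ.comp (by fun_prop))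
  · rw [mem_ball_zero_iff, Real.norm_eq_abs, abs_of_nonneg (mul_nonneg hpm.le ht.1)]
    exact (mul_le_of_le_one_right hpm.le ht.2).trans_lt hm
  · simpa using hval 0

end CurveThroughPoints

section PiecewiseC1

variable {n : ℕ} {γ σ : ℝ → Fin n → ℂ}

/-- A curve is piecewise `C¹` if and only if it is `C¹` on every interval which avoids some finite
set of break points. -/
theorem piecewiseC1_iff : PiecewiseC1 γ ↔ ContinuousOn γ (Icc 0 1) ∧ ∃ T : Finset ℝ, ∀ u v,
    0 ≤ u → u < v → v ≤ 1 → (∀ s ∈ T, s ∉ Ioo u v) → ContDiffOn ℝ 1 γ (Icc u v) := by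
  refine and_congr_right fun _ => ⟨?_, ?_⟩
  · rintro ⟨k, t, -, ht0, ht1, ht⟩
    refine ⟨Finset.univ.image t, fun u v hu huv hv hT => ?_⟩
    obtain ⟨i, hi, hi'⟩ : ∃ i : Fin k, t i.castSucc ≤ u ∧ u < t i.succ := by
      by_contra! hcon
      have : ∀ i, t i ≤ u := fun i => by
        induction i using Fin.induction with
        | zero => rwa [ht0]
        | succ i ih => exact hcon i ih
      linarith [this (Fin.last k)]
    refine (ht i).mono (Icc_subset_Icc hi ?_)
    by_contra! hlt
    exact hT (t i.succ) (Finset.mem_image_of_mem _ (Finset.mem_univ _)) ⟨hi', hlt⟩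
  · rintro ⟨T, hT⟩
    set s : Finset ℝ := insert 0 (insert 1 (T.filter (· ∈ Ioo (0 : ℝ) 1))) with hs
    have hs01 : ∀ x ∈ s, 0 ≤ x ∧ x ≤ 1 := fun x hx => by
      simp only [hs, Finset.mem_insert, Finset.mem_filter] at hx
      rcases hx with rfl | rfl | ⟨-, h⟩
      · norm_num
      · norm_num
      · exact ⟨h.1.le, h.2.le⟩
    have h0s : (0 : ℝ) ∈ s := by simp [hs]
    have h1s : (1 : ℝ) ∈ s := by simp [hs]
    obtain ⟨k, hk⟩ : ∃ k, s.card = k + 1 := Nat.exists_eq_succ_of_ne_zero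
      (Finset.card_ne_zero_of_mem h0s)
    set t := s.orderEmbOfFin hk with ht
    have hts : ∀ i, t i ∈ s := fun i => Finset.orderEmbOfFin_mem s hk i
    have hsurj : ∀ x ∈ s, ∃ i, t i = x := fun x hx => by
      have : x ∈ range t := by rw [ht, Finset.range_orderEmbOfFin]; exact hx
      exact this
    refine ⟨k, t, t.strictMono, ?_, ?_, fun i => ?_⟩
    · obtain ⟨i, hi⟩ := hsurj 0 h0s
      exact le_antisymm (hi ▸ t.monotone (Fin.zero_le i)) (hs01 _ (hts 0)).1
    · obtain ⟨i, hi⟩ := hsurj 1 h1s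
      exact le_antisymm (hs01 _ (hts _)).2 (hi ▸ t.monotone (Fin.le_last i))
    · refine hT _ _ (hs01 _ (hts _)).1 (t.strictMono i.castSucc_lt_succ) (hs01 _ (hts _)).2
        fun x hxT hx => ?_
      obtain ⟨j, rfl⟩ := hsurj x (by
        simp only [hs, Finset.mem_insert, Finset.mem_filter]
        exact Or.inr (Or.inr ⟨hxT, (hs01 _ (hts _)).1.trans_lt hx.1,
          hx.2.trans_le (hs01 _ (hts _)).2⟩))
      have h1 := t.lt_iff_lt.1 hx.1
      have h2 := t.lt_iff_lt.1 hx.2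
      rw [Fin.lt_def] at h1 h2
      simp only [Fin.val_castSucc, Fin.val_succ] at h1 h2
      omega

theorem ContDiff.piecewiseC1 (hσ : ContDiff ℝ 1 σ) : PiecewiseC1 σ :=
  piecewiseC1_iff.2 ⟨hσ.continuous.continuousOn, ∅, fun _ _ _ _ _ _ => hσ.contDiffOn⟩

namespace PiecewiseC1

theorem comp_mul_left (hγ : PiecewiseC1 γ) {c : ℝ} (hc : 0 < c) (hc1 : c ≤ 1) :
    PiecewiseC1 fun t => γ (c * t) := by
  obtain ⟨hcont, T, hT⟩ := piecewiseC1_iff.1 hγ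
  refine piecewiseC1_iff.2 ⟨hcont.comp (by fun_prop) fun t ht =>
    ⟨mul_nonneg hc.le ht.1, mul_le_one₀ hc1 ht.1 ht.2⟩, T.image (· / c), fun u v hu huv hv h => ?_⟩
  refine (hT (c * u) (c * v) (by positivity) (by gcongr)
    (mul_le_one₀ hc1 (hu.trans huv.le) hv) fun s hs hsI => ?_).comp
      (f := fun t : ℝ => c * t) (by fun_prop)
      fun t ht => ⟨mul_le_mul_of_nonneg_left ht.1 hc.le, mul_le_mul_of_nonneg_left ht.2 hc.le⟩
  refine h (s / c) (Finset.mem_image_of_mem _ hs) ⟨?_, ?_⟩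
  · rw [lt_div_iff₀ hc]; linarith [hsI.1]
  · rw [div_lt_iff₀ hc]; linarith [hsI.2]

/-- Concatenation of curves. -/
theorem concat (hγ : PiecewiseC1 γ) (hσ : ContDiff ℝ 1 σ) (h : γ 1 = σ 0) :
    PiecewiseC1 fun t => if t ≤ 1 / 2 then γ (2 * t) else σ (2 * t - 1) := by
  set Γ : ℝ → Fin n → ℂ := fun t => if t ≤ 1 / 2 then γ (2 * t) else σ (2 * t - 1) with hΓ
  have h1 : ∀ t, t ≤ 1 / 2 → Γ t = γ (2 * t) := fun t ht => if_pos ht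
  have h2 : ∀ t, 1 / 2 ≤ t → Γ t = σ (2 * t - 1) := fun t ht => by
    rcases ht.eq_or_lt with rfl | ht
    · rw [h1 _ le_rfl]; norm_num [h]
    · exact if_neg ht.not_ge
  obtain ⟨hcont, T, hT⟩ := piecewiseC1_iff.1 hγ
  have hσ' : ContDiff ℝ 1 fun t => σ (2 * t - 1) := hσ.comp (by fun_prop)
  refine piecewiseC1_iff.2 ⟨?_, insert (1 / 2) (T.image (· / 2)), fun u v hu huv hv hI => ?_⟩
  · rw [← Icc_union_Icc_eq_Icc (b := (1 : ℝ) / 2) (by norm_num) (by norm_num)]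
    refine ContinuousOn.union_of_isClosed ?_ ?_ isClosed_Icc isClosed_Icc
    · refine ContinuousOn.congr (hcont.comp (f := fun t : ℝ => 2 * t) (by fun_prop) fun t ht => ?_)
        fun t ht => h1 t ht.2
      exact ⟨by linarith [ht.1], by linarith [ht.2]⟩
    · exact hσ'.continuous.continuousOn.congr fun t ht => h2 t ht.1
  · rcases le_or_gt v (1 / 2) with hv2 | hv2
    · refine ContDiffOn.congr ((hT (2 * u) (2 * v) (by positivity) (by linarith) (by linarith)
        fun s hs hsI => ?_).comp (f := fun t : ℝ => 2 * t) (by fun_prop)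
        fun t ht => ⟨by linarith [ht.1], by linarith [ht.2]⟩) fun t ht => h1 t (ht.2.trans hv2)
      refine hI (s / 2) (Finset.mem_insert_of_mem (Finset.mem_image_of_mem _ hs)) ⟨?_, ?_⟩
      · linarith [hsI.1]
      · linarith [hsI.2]
    · have hu2 : 1 / 2 ≤ u := by
        by_contra! hlt
        exact hI _ (Finset.mem_insert_self _ _) ⟨hlt, hv2⟩
      exact hσ'.contDiffOn.congr fun t ht => h2 t (hu2.trans ht.1)

end PiecewiseC1

end PiecewiseC1

section BergmanBalls

variable {n : ℕ} {X : Set (Fin n → ℂ)} {K : (Fin n → ℂ) → (Fin n → ℂ) → ℂ} {γ : ℝ → Fin n → ℂ}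
  {p z : Fin n → ℂ} {r : ℝ}

theorem bergmanMetric_nonneg (z ξ : Fin n → ℂ) : 0 ≤ bergmanMetric K z ξ := Real.sqrt_nonneg _

theorem bergmanMetric_smul (z ξ : Fin n → ℂ) {c : ℝ} (hc : 0 ≤ c) :
    bergmanMetric K z (c • ξ) = c * bergmanMetric K z ξ := by
  have h : bergmanQuad K z (c • ξ) = c ^ 2 * bergmanQuad K z ξ := by
    rw [bergmanQuad, bergmanQuad, ← Complex.re_ofReal_mul]
    congr 1
    simp only [Finset.mul_sum, Pi.smul_apply, Complex.real_smul, map_mul, Complex.conj_ofReal]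
    push_cast
    refine Finset.sum_congr rfl fun μ _ => Finset.sum_congr rfl fun ν _ => ?_
    ring
  rw [bergmanMetric, h, Real.sqrt_mul (sq_nonneg c), Real.sqrt_sq hc, bergmanMetric]

theorem bergmanLength_comp_mul_left (γ : ℝ → Fin n → ℂ) {c : ℝ} (hc : 0 ≤ c) :
    bergmanLength K (fun t => γ (c * t)) =
      ∫ t in (0 : ℝ)..c, bergmanMetric K (γ t) (deriv γ t) := by
  have h := intervalIntegral.smul_integral_comp_mul_left (a := 0) (b := 1)
    (fun t => bergmanMetric K (γ t) (deriv γ t)) c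
  rw [mul_zero, mul_one] at h
  rw [bergmanLength, ← h, smul_eq_mul, ← intervalIntegral.integral_const_mul]
  refine intervalIntegral.integral_congr fun t _ => ?_
  rw [deriv_comp_mul_left, bergmanMetric_smul _ _ hc]

theorem bergmanDist_le_bergmanLength (hγ : PiecewiseC1 γ) (hX : MapsTo γ (Icc 0 1) X) :
    bergmanDist X K (γ 0) (γ 1) ≤ bergmanLength K γ := by
  refine csInf_le ⟨0, ?_⟩ ⟨γ, rfl, rfl, hX, hγ, rfl⟩
  rintro L ⟨σ, -, -, -, -, rfl⟩
  exact intervalIntegral.integral_nonneg zero_le_one fun t _ => bergmanMetric_nonneg _ _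

theorem bergmanDist_le_integral (hγ : PiecewiseC1 γ) (hX : MapsTo γ (Icc 0 1) X) {t : ℝ}
    (ht : t ∈ Ioc (0 : ℝ) 1) : bergmanDist X K (γ 0) (γ t) ≤
      ∫ s in (0 : ℝ)..t, bergmanMetric K (γ s) (deriv γ s) := by
  rw [← bergmanLength_comp_mul_left γ ht.1.le]
  have := bergmanDist_le_bergmanLength (K := K) (hγ.comp_mul_left ht.1 ht.2)
    (X := X) fun s hs => hX ⟨mul_nonneg ht.1.le hs.1, mul_le_one₀ ht.2 hs.1 hs.2⟩
  simpa using this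

theorem bergmanLength_const (p : Fin n → ℂ) : bergmanLength K (fun _ => p) = 0 := by
  have h : bergmanMetric K p 0 = 0 := by
    simpa using bergmanMetric_smul (K := K) p 0 le_rfl
  simp [bergmanLength, h]

theorem mem_bergmanBall_self (hp : p ∈ X) (hr : 0 < r) : p ∈ bergmanBall X K p r := by
  refine ⟨hp, lt_of_le_of_lt ?_ hr⟩
  have := bergmanDist_le_bergmanLength (K := K) (X := X) (γ := fun _ => p)
    contDiff_const.piecewiseC1 fun _ _ => hp
  rwa [bergmanLength_const] at this

/-- If the Bergman pseudodistance is a distance then curves with different end points have an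
integrable speed. -/
theorem BergmanDistIsDistance.intervalIntegrable (h : BergmanDistIsDistance X K)
    (hγ : PiecewiseC1 γ) (hX : MapsTo γ (Icc 0 1) X) (hne : γ 0 ≠ γ 1) :
    IntervalIntegrable (fun t => bergmanMetric K (γ t) (deriv γ t)) volume 0 1 := by
  by_contra hcon
  have := bergmanDist_le_bergmanLength (K := K) hγ hX
  rw [bergmanLength, intervalIntegral.integral_undef hcon] at this
  exact (h _ (hX (by simp)) _ (hX (by simp)) hne).not_ge this

theorem BergmanDistIsDistance.exists_curve (h : BergmanDistIsDistance X K) (hp : p ∈ X)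
    (hz : z ∈ bergmanBall X K p r) (hr : 0 < r) :
    ∃ γ : ℝ → Fin n → ℂ, γ 0 = p ∧ γ 1 = z ∧ MapsTo γ (Icc 0 1) X ∧ PiecewiseC1 γ ∧
      bergmanLength K γ < r := by
  rcases eq_or_ne p z with rfl | hne
  · exact ⟨fun _ => p, rfl, rfl, fun _ _ => hp, contDiff_const.piecewiseC1,
      by rwa [bergmanLength_const]⟩
  · have hpos := h p hp z hz.1 hne
    obtain ⟨_, ⟨γ, h0, h1, hX, hγ, rfl⟩, hL⟩ := exists_lt_of_csInf_lt (by
      by_contra hemp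
      rw [not_nonempty_iff_eq_empty] at hemp
      rw [bergmanDist, hemp, Real.sInf_empty] at hpos
      exact lt_irrefl _ hpos) hz.2
    exact ⟨γ, h0, h1, hX, hγ, hL⟩

theorem BergmanDistIsDistance.isPreconnected_bergmanBall (h : BergmanDistIsDistance X K)
    (hp : p ∈ X) (hr : 0 < r) : IsPreconnected (bergmanBall X K p r) := by
  refine isPreconnected_of_forall p fun z hz => ?_
  rcases eq_or_ne p z with rfl | hne
  · exact ⟨{p}, by simpa using hz, rfl, rfl, isPreconnected_singleton⟩
  obtain ⟨γ, rfl, rfl, hX, hγ, hL⟩ := h.exists_curve hp hz hr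
  refine ⟨γ '' Icc 0 1, ?_, ⟨0, by simp, rfl⟩, ⟨1, by simp, rfl⟩,
    isPreconnected_Icc.image _ hγ.1⟩
  rintro _ ⟨t, ht, rfl⟩
  rcases ht.1.eq_or_lt with rfl | ht0
  · exact mem_bergmanBall_self hp hr
  refine ⟨hX ht, (bergmanDist_le_integral hγ hX ⟨ht0, ht.2⟩).trans_lt (lt_of_le_of_lt ?_ hL)⟩
  exact intervalIntegral.integral_mono_interval le_rfl ht.1 ht.2
    (Eventually.of_forall fun t => bergmanMetric_nonneg _ _) (h.intervalIntegrable hγ hX hne)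

theorem BergmanDistIsDistance.isOpen_bergmanBall (h : BergmanDistIsDistance X K) (hXo : IsOpen X)
    (hp : p ∈ X) (hr : 0 < r) : IsOpen (bergmanBall X K p r) := by
  refine isOpen_iff_mem_nhds.2 fun z hz => ?_
  by_contra hnhds
  rw [← mem_interior_iff_mem_nhds, ← mem_compl_iff, ← closure_compl] at hnhds
  obtain ⟨σ, hσ, hσ0, hσX, hσ1, τ, hτ, hτ0, hτA⟩ :=
    exists_contDiff_curve_of_mem_closure hXo hz.1 hnhds
  obtain ⟨γ, rfl, rfl, hX, hγ, hL⟩ := h.exists_curve hp hz hr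
  have hΓ := hγ.concat hσ hσ0.symm
  set Γ : ℝ → Fin n → ℂ := fun t => if t ≤ 1 / 2 then γ (2 * t) else σ (2 * t - 1) with hΓdef
  have hΓl : ∀ t, t ≤ 1 / 2 → Γ t = γ (2 * t) := fun t ht => if_pos ht
  have hΓr : ∀ t, 1 / 2 < t → Γ t = σ (2 * t - 1) := fun t ht => if_neg ht.not_ge
  have hΓ0 : Γ 0 = γ 0 := by rw [hΓl 0 (by norm_num), mul_zero]
  have hΓ1 : Γ 1 = σ 1 := by rw [hΓr 1 (by norm_num)]; norm_num
  have hΓX : MapsTo Γ (Icc 0 1) X := fun t ht => by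
    rcases le_or_gt t (1 / 2) with h2 | h2
    · rw [hΓl t h2]; exact hX ⟨by linarith [ht.1], by linarith⟩
    · rw [hΓr t h2]; exact hσX ⟨by linarith, by linarith [ht.2]⟩
  have hspeed := h.intervalIntegrable hΓ hΓX (by
    rw [hΓ0, hΓ1]
    intro heq
    exact hσ1 (heq ▸ mem_bergmanBall_self hp hr))
  have hhalf : ∫ t in (0 : ℝ)..1 / 2, bergmanMetric K (Γ t) (deriv Γ t) = bergmanLength K γ := by
    have h1 : bergmanLength K γ = bergmanLength K fun t => (fun s => γ (2 * s)) (1 / 2 * t) := by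
      congr 1; ext t; congr 1; ring
    rw [h1, bergmanLength_comp_mul_left (fun s => γ (2 * s)) (by norm_num)]
    refine intervalIntegral.integral_congr_Ioo_of_le (by norm_num) fun t ht => ?_
    have : Γ =ᶠ[𝓝 t] fun s => γ (2 * s) := by
      filter_upwards [Iio_mem_nhds ht.2] with s hs using hΓl s (le_of_lt hs)
    rw [this.deriv_eq, this.eq_of_nhds]
  have hτhalf : Tendsto (fun k => (1 + τ k) / 2) atTop (𝓝 (1 / 2)) := by
    simpa using (hτ0.const_add 1).div_const 2
  have hcont := intervalIntegral.continuousOn_primitive_interval' hspeed left_mem_uIcc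
  rw [uIcc_of_le zero_le_one] at hcont
  have hlim := (hcont (1 / 2) (by norm_num)).tendsto.comp (tendsto_nhdsWithin_iff.2
    ⟨hτhalf, Eventually.of_forall fun k => ⟨by linarith [(hτ k).1], by linarith [(hτ k).2]⟩⟩)
  rw [hhalf] at hlim
  refine (ge_of_tendsto hlim (Eventually.of_forall fun k => ?_)).not_gt hL
  have hval : Γ ((1 + τ k) / 2) = σ (τ k) := by
    rw [hΓr _ (by linarith [(hτ k).1])]; congr 1; ring
  have hle := bergmanDist_le_integral (K := K) hΓ hΓX (t := (1 + τ k) / 2)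
    ⟨by linarith [(hτ k).1], by linarith [(hτ k).2]⟩
  refine le_trans ?_ hle
  rw [hΓ0, hval]
  by_contra! hlt
  exact hτA k ⟨hσX ⟨(hτ k).1.le, (hτ k).2⟩, hlt⟩

end BergmanBalls

section Fridman

theorem mem_euclUnitBall_iff {n : ℕ} {z : Fin n → ℂ} :
    z ∈ euclUnitBall n ↔ WithLp.toLp 2 z ∈ ball (0 : EuclideanSpace ℂ (Fin n)) 1 := by
  rw [mem_ball_zero_iff, EuclideanSpace.norm_eq, Real.sqrt_lt' one_pos, one_pow]
  rfl

theorem image_euclUnitBall (n : ℕ) :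
    EuclideanSpace.equiv (Fin n) ℂ '' ball 0 1 = euclUnitBall n := by
  ext z
  rw [mem_euclUnitBall_iff]
  constructor
  · rintro ⟨w, hw, rfl⟩
    exact hw
  · exact fun hz => ⟨_, hz, rfl⟩

end Fridman

/-- on a taut domain the infimum defining `h_X(x⁰) > 0` is attained. -/
theorem fridman_infimum_attained {n : ℕ} (X : Set (Fin n → ℂ))
    (hXopen : IsOpen X) (hXconn : IsConnected X) (htaut : IsTaut X)
    (K : (Fin n → ℂ) → (Fin n → ℂ) → ℂ) (hK : IsBergmanKernel X K)
    (hdist : BergmanDistIsDistance X K)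
    (x0 : Fin n → ℂ) (hx0 : x0 ∈ X) (hpos : 0 < fridmanInv X K x0) :
    ∃ F : (Fin n → ℂ) → (Fin n → ℂ), DifferentiableOn ℂ F (euclUnitBall n) ∧
      Set.InjOn F (euclUnitBall n) ∧ F '' euclUnitBall n ⊆ X ∧
      bergmanBall X K x0 (1 / fridmanInv X K x0) ⊆ F '' euclUnitBall n := by
  set e := EuclideanSpace.equiv (Fin n) ℂ with he
  have heim : e '' ball 0 1 = euclUnitBall n := image_euclUnitBall n
  have hmaps : MapsTo e (ball 0 1) (euclUnitBall n) := heim ▸ mapsTo_image _ _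
  have hmaps' : MapsTo e.symm (euclUnitBall n) (ball 0 1) := fun z hz => by
    rw [← heim] at hz
    obtain ⟨w, hw, rfl⟩ := hz
    simpa using hw
  have hR : 0 < 1 / fridmanInv X K x0 := one_div_pos.2 hpos
  have hstep : ∀ j : ℕ, ∃ f : EuclideanSpace ℂ (Fin n) → Fin n → ℂ,
      DifferentiableOn ℂ f (ball 0 1) ∧ InjOn f (ball 0 1) ∧ MapsTo f (ball 0 1) X ∧ f 0 = x0 ∧
      bergmanBall X K x0 (1 / (fridmanInv X K x0 + 1 / (j + 1))) ⊆ f '' ball 0 1 := by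
    intro j
    have hlt : fridmanInv X K x0 < fridmanInv X K x0 + 1 / (j + 1) := by
      have : (0 : ℝ) < 1 / (j + 1) := by positivity
      linarith
    obtain ⟨c, ⟨r, hr, rfl, g, hgd, hgi, hgX, hgB⟩, hc⟩ := exists_lt_of_csInf_lt (by
      by_contra hemp
      rw [not_nonempty_iff_eq_empty] at hemp
      rw [fridmanInv, hemp, Real.sInf_empty] at hpos
      exact lt_irrefl _ hpos) hlt
    obtain ⟨q, hq, hqx⟩ := hgB (mem_bergmanBall_self hx0 hr)
    have ha : ‖e.symm q‖ < 1 := mem_ball_zero_iff.1 (hmaps' hq)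
    set ψ := ballInvolution (e.symm q) with hψ
    have hψm : MapsTo (fun z => e (ψ z)) (ball 0 1) (euclUnitBall n) :=
      hmaps.comp (mapsTo_ballInvolution ha)
    have him : (fun z => g (e (ψ z))) '' ball 0 1 = g '' euclUnitBall n := by
      rw [← heim, ← image_image (fun z => g (e z)) ψ, image_ballInvolution ha, ← image_image g e]
    refine ⟨fun z => g (e (ψ z)), ?_, ?_, ?_, ?_, ?_⟩
    · exact hgd.comp (e.differentiable.comp_differentiableOn (differentiableOn_ballInvolution ha))
        hψm
    · exact hgi.comp (e.injective.injOn.comp (injOn_ballInvolution ha) (mapsTo_univ _ _)) hψm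
    · exact fun z hz => hgX ⟨_, hψm hz, rfl⟩
    · simp only [hψ, ballInvolution_zero, e.apply_symm_apply, hqx]
    · rw [him]
      refine fun z hz => hgB ⟨hz.1, hz.2.trans_le ?_⟩
      rw [one_div_le (hpos.trans hlt) hr]
      exact hc.le
  choose f hfd hfi hfX hf0 hfB using hstep
  have hlim : Tendsto (fun j : ℕ => 1 / (fridmanInv X K x0 + 1 / ((j : ℝ) + 1))) atTop
      (𝓝 (1 / fridmanInv X K x0)) := by
    have := (tendsto_one_div_add_atTop_nhds_zero_nat (𝕜 := ℝ)).const_add (fridmanInv X K x0)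
    rw [add_zero] at this
    exact tendsto_const_nhds.div this hpos.ne'
  obtain ⟨F, hFd, hFi, hFX, hFS⟩ := htaut.exists_injOn_subset_image (by simp) hx0 hfd hfi hfX hf0
    (mem_bergmanBall_self (K := K) hx0 hR) fun z hz => by
      obtain ⟨ρ, hzρ, hρ⟩ := exists_between (max_lt hz.2 hR)
      obtain ⟨hzρ, hρ0⟩ := max_lt_iff.1 hzρ
      refine ⟨bergmanBall X K x0 ρ, hdist.isOpen_bergmanBall hXopen hx0 hρ0,
        hdist.isPreconnected_bergmanBall hx0 hρ0, mem_bergmanBall_self hx0 hρ0, ⟨hz.1, hzρ⟩, ?_⟩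
      filter_upwards [hlim.eventually_const_lt hρ] with j hj
      exact fun y hy => hfB j ⟨hy.1, hy.2.trans hj⟩
  have him : (fun z => F (e.symm z)) '' euclUnitBall n = F '' ball 0 1 := by
    rw [← heim, image_image]
    simp
  refine ⟨fun z => F (e.symm z), hFd.comp e.symm.differentiable.differentiableOn hmaps',
    hFi.comp e.symm.injective.injOn hmaps', ?_, him ▸ hFS⟩
  rw [him]
  exact hFX.image_subset

end
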